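/- Let R be a Gorenstein local ring, let c be a perfect Gorenstein ideal of R, and let L be a finitely generated R-module. Assume M ∈ CM^n(R) and M ∼_c N (M is linked to N by c). Then: (i) Êxt^i_R(L,M) = 0 for all i ≫ 0 if and only if T̂or_i^R(L,N) = 0 for all i ≫ 0; (ii) Êxt^i_R(L,M) = 0 for all i ≪ 0 if and only if T̂or_i^R(L,N) = 0 for all i ≪ 0; (iii) Êxt^i_R(L,M) = 0 for all i ∈ ℤ if and only if T̂or_i^R(L,N) = 0 for all i ∈ ℤ. -/

import Mathlib

open CategoryTheory CategoryTheory.Limits CategoryTheory.MonoidalCategory Opposite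

noncomputable section

universe u

variable (R : Type u) [CommRing R]

/-- Ordinary `Ext` of `R`-modules, via the derived functor `Ext` of Mathlib. -/
abbrev ExtMod (n : ℕ) (M N : ModuleCat.{u} R) : ModuleCat.{u} R :=
  ((Ext R (ModuleCat.{u} R) n).obj (op M)).obj N

/-- Ordinary `Tor` of `R`-modules, via the derived functor `Tor` of Mathlib. -/
abbrev TorMod (n : ℕ) (M N : ModuleCat.{u} R) : ModuleCat.{u} R :=
  ((Tor (ModuleCat.{u} R) n).obj M).obj N

/-- A finitely generated module `M` is totally reflexive (of G-dimension zero) if the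
biduality map is an isomorphism and `Ext^i(M,R) = 0 = Ext^i(M^*,R)` for all `i > 0`. -/
def IsTotallyReflexive (M : ModuleCat.{u} R) : Prop :=
  Module.Finite R M ∧
  Function.Bijective (Module.Dual.eval R M) ∧
  (∀ i : ℕ, 0 < i → IsZero (ExtMod R i M (ModuleCat.of R R))) ∧
  (∀ i : ℕ, 0 < i → IsZero (ExtMod R i (ModuleCat.of R (Module.Dual R M)) (ModuleCat.of R R)))

/-- `M` admits a resolution `0 → G_n → ⋯ → G_0 → M → 0` by totally reflexive modules. -/
def GDimLE (M : ModuleCat.{u} R) (n : ℕ) : Prop :=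
  ∃ (G : ChainComplex (ModuleCat.{u} R) ℕ) (ε : G.X 0 ⟶ M),
    (∀ i, i ≤ n → IsTotallyReflexive R (G.X i)) ∧
    (∀ i, n < i → IsZero (G.X i)) ∧
    Epi ε ∧
    (∃ w : G.d 1 0 ≫ ε = 0, (ShortComplex.mk (G.d 1 0) ε w).Exact) ∧
    (∀ i, 0 < i → G.ExactAt i)

/-- `M` has finite Gorenstein dimension. -/
def HasFiniteGDim (M : ModuleCat.{u} R) : Prop := ∃ n, GDimLE R M n

/-- The Gorenstein dimension of `M`, as an element of `ℕ∞`. -/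
def gdim (M : ModuleCat.{u} R) : ℕ∞ :=
  sInf {c : ℕ∞ | ∃ n : ℕ, c = n ∧ GDimLE R M n}

/-- `M` admits a projective resolution of length at most `n`. -/
def PdLE (M : ModuleCat.{u} R) (n : ℕ) : Prop :=
  ∃ (G : ChainComplex (ModuleCat.{u} R) ℕ) (ε : G.X 0 ⟶ M),
    (∀ i, Projective (G.X i)) ∧
    (∀ i, n < i → IsZero (G.X i)) ∧
    Epi ε ∧
    (∃ w : G.d 1 0 ≫ ε = 0, (ShortComplex.mk (G.d 1 0) ε w).Exact) ∧
    (∀ i, 0 < i → G.ExactAt i)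

/-- `M` has finite projective dimension. -/
def HasFinitePd (M : ModuleCat.{u} R) : Prop := ∃ n, PdLE R M n

/-- The projective dimension of `M`, as an element of `ℕ∞`. -/
def pdim (M : ModuleCat.{u} R) : ℕ∞ :=
  sInf {c : ℕ∞ | ∃ n : ℕ, c = n ∧ PdLE R M n}

/-- `M` admits an injective resolution `0 → M → I^0 → ⋯ → I^n → 0`. -/
def InjDimLE (M : ModuleCat.{u} R) (n : ℕ) : Prop :=
  ∃ (I : CochainComplex (ModuleCat.{u} R) ℕ) (ι : M ⟶ I.X 0),
    (∀ i, Injective (I.X i)) ∧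
    (∀ i, n < i → IsZero (I.X i)) ∧
    Mono ι ∧
    (∃ w : ι ≫ I.d 0 1 = 0, (ShortComplex.mk ι (I.d 0 1) w).Exact) ∧
    (∀ i, 0 < i → I.ExactAt i)

/-- `M` has finite injective dimension. -/
def HasFiniteInjDim (M : ModuleCat.{u} R) : Prop := ∃ n, InjDimLE R M n

/-- A Gorenstein local ring: a commutative Noetherian local ring of finite self-injective
dimension. -/
def IsGorensteinLocalRing : Prop :=
  IsLocalRing R ∧ IsNoetherianRing R ∧ HasFiniteInjDim R (ModuleCat.of R R)

/-- The grade of a module: `grade M = inf { i | Ext^i(M,R) ≠ 0 }`. -/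
def gradeM (M : ModuleCat.{u} R) : ℕ∞ :=
  sInf {c : ℕ∞ | ∃ i : ℕ, c = i ∧ ¬ IsZero (ExtMod R i M (ModuleCat.of R R))}

/-- A module is G-perfect if its grade equals its Gorenstein dimension. -/
def IsGPerfect (M : ModuleCat.{u} R) : Prop := gradeM R M = gdim R M

/-- An ideal `c` is perfect if `grade (R/c) = pd (R/c)`. -/
def IsPerfectIdeal (c : Ideal R) : Prop :=
  gradeM R (ModuleCat.of R (R ⧸ c)) = pdim R (ModuleCat.of R (R ⧸ c))

/-- A complete resolution `T → P → M` of `M`: `P → M` is a resolution by finite projective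
modules, `T` is a totally acyclic complex of finite projective modules, and `θ i` is an
isomorphism for all `i ≫ 0`. -/
structure CompleteResolution (M : ModuleCat.{u} R) where
  T : ChainComplex (ModuleCat.{u} R) ℤ
  P : ChainComplex (ModuleCat.{u} R) ℤ
  θ : T ⟶ P
  π : P.X 0 ⟶ M
  projT : ∀ i, Projective (T.X i)
  fgT : ∀ i, Module.Finite R (T.X i)
  projP : ∀ i, Projective (P.X i)
  fgP : ∀ i, Module.Finite R (P.X i)
  zeroP : ∀ i : ℤ, i < 0 → IsZero (P.X i)
  epiπ : Epi π
  wπ : P.d 1 0 ≫ π = 0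
  exact0 : (ShortComplex.mk (P.d 1 0) π wπ).Exact
  exactP : ∀ i : ℤ, 0 < i → P.ExactAt i
  exactT : ∀ i : ℤ, T.ExactAt i
  exactTdual : ∀ i : ℤ, (T.linearYonedaObj R (ModuleCat.of R R)).ExactAt i
  iso_eventually : ∃ n₀ : ℤ, ∀ i : ℤ, n₀ ≤ i → IsIso (θ.f i)

/-- Tate cohomology `Êxt^i(M,N) = H^i(Hom(T,N))` computed from a complete resolution of `M`. -/
def TateExt {M : ModuleCat.{u} R} (C : CompleteResolution R M) (N : ModuleCat.{u} R)
    (i : ℤ) : ModuleCat.{u} R :=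
  (C.T.linearYonedaObj R N).homology i

/-- Tate homology `T̂or_i(M,N) = H_i(T ⊗ N)` computed from a complete resolution of `M`. -/
def TateTor {M : ModuleCat.{u} R} (C : CompleteResolution R M) (N : ModuleCat.{u} R)
    (i : ℤ) : ModuleCat.{u} R :=
  ((((tensoringRight (ModuleCat.{u} R)).obj N).mapHomologicalComplex _).obj C.T).homology i

/-- The depth of a module over a local ring: the supremum of the lengths of the
`M`-regular sequences contained in the maximal ideal. -/
def moduleDepth [IsLocalRing R] (M : Type u) [AddCommGroup M] [Module R M] : ℕ∞ :=
  sSup {c : ℕ∞ | ∃ rs : List R, c = rs.length ∧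
    (∀ r ∈ rs, r ∈ IsLocalRing.maximalIdeal R) ∧ RingTheory.Sequence.IsRegular M rs}

/-- `E` is an injective envelope of the residue field `k`: an injective module which is an
essential extension of `k`. -/
def IsInjectiveEnvelopeOfResidueField [IsLocalRing R] (E : Type u) [AddCommGroup E]
    [Module R E] : Prop :=
  Injective (ModuleCat.of R E) ∧
  ∃ ι : IsLocalRing.ResidueField R →ₗ[R] E,
    Function.Injective ι ∧
    ∀ N : Submodule R E, N ≠ ⊥ → N ⊓ LinearMap.range ι ≠ ⊥


/-- A minimal free resolution `⋯ → F_1 → F_0 → M → 0` of a finitely generated module over a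
local ring, recorded by its Betti numbers `b n` and differentials with image inside
`m • F_n`. -/
structure MinFreeRes [IsLocalRing R] (M : Type u) [AddCommGroup M] [Module R M] where
  b : ℕ → ℕ
  d : ∀ n : ℕ, ((Fin (b (n+1)) → R) →ₗ[R] (Fin (b n) → R))
  aug : (Fin (b 0) → R) →ₗ[R] M
  aug_surj : Function.Surjective aug
  exact_zero : LinearMap.ker aug = LinearMap.range (d 0)
  exact_succ : ∀ n, LinearMap.ker (d n) = LinearMap.range (d (n+1))
  minimal : ∀ n, LinearMap.range (d n) ≤ (IsLocalRing.maximalIdeal R) • ⊤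

/-- The Betti numbers of `M` are eventually bounded by `γ · n^(c-1)`. -/
def CxLE [IsLocalRing R] (M : Type u) [AddCommGroup M] [Module R M] (c : ℕ) : Prop :=
  ∃ (F : MinFreeRes R M) (γ : ℝ) (n₀ : ℕ),
    ∀ n : ℕ, n₀ ≤ n → (F.b n : ℝ) ≤ γ * (n : ℝ) ^ ((c : ℤ) - 1)

/-- The complexity of a module: the least `c` such that the Betti numbers are eventually
bounded by `γ · n^(c-1)` for some `γ`. -/
def complexity [IsLocalRing R] (M : Type u) [AddCommGroup M] [Module R M] : ℕ∞ :=
  sInf {e : ℕ∞ | ∃ c : ℕ, e = c ∧ CxLE R M c}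

/-- The pushout `K_η` of a map `f : Ω^{j+1} M → M` (representing a degree-`(j+1)`
homogeneous element `η` of `Ext^*(M,M)`) along the inclusion `Ω^{j+1} M ↪ F_j`: the
cokernel of `(f, -incl) : Ω^{j+1} M → M ⊕ F_j`. -/
abbrev PushoutMod [IsLocalRing R] {M : Type u} [AddCommGroup M] [Module R M]
    (F : MinFreeRes R M) (j : ℕ) (f : LinearMap.range (F.d j) →ₗ[R] M) : Type u :=
  (M × (Fin (F.b j) → R)) ⧸
    LinearMap.range (LinearMap.prod f (-(LinearMap.range (F.d j)).subtype))

/-- Auxiliary predicate: `M` has reducible complexity, with recursion depth `≤ c`. -/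
def RedCxAux [IsLocalRing R] :
    ℕ → ∀ (M : Type u) (_ : AddCommGroup M) (_ : Module R M), Prop
  | 0, M, g, m =>
      letI := g; letI := m
      HasFinitePd R (ModuleCat.of R M)
  | (c+1), M, g, m =>
      letI := g; letI := m
      HasFinitePd R (ModuleCat.of R M) ∨
      (complexity R M < ⊤ ∧ 0 < complexity R M ∧
        ∃ (j : ℕ) (F : MinFreeRes R M) (f : LinearMap.range (F.d j) →ₗ[R] M),
          complexity R (PushoutMod R F j f) < complexity R M ∧
          moduleDepth R (PushoutMod R F j f) = moduleDepth R M ∧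
          RedCxAux c (PushoutMod R F j f) inferInstance inferInstance)

/-- `M` has reducible complexity. -/
def HasReducibleComplexity [IsLocalRing R] (M : Type u) [AddCommGroup M] [Module R M] :
    Prop :=
  ∃ c : ℕ, RedCxAux R c M inferInstance inferInstance

/-- `L` is (isomorphic to) `λ N = Ω Tr N`, computed from a minimal free presentation of `N`
over the local ring `S`. -/
def IsLambdaOf (S : Type u) [CommRing S] [IsLocalRing S]
    (N L : Type u) [AddCommGroup N] [Module S N] [AddCommGroup L] [Module S L] : Prop :=
  ∃ (n₀ n₁ : ℕ) (g : (Fin n₀ → S) →ₗ[S] N) (f : (Fin n₁ → S) →ₗ[S] (Fin n₀ → S)),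
    Function.Surjective g ∧
    LinearMap.range f = LinearMap.ker g ∧
    LinearMap.ker g ≤ (IsLocalRing.maximalIdeal S) • ⊤ ∧
    LinearMap.ker f ≤ (IsLocalRing.maximalIdeal S) • ⊤ ∧
    Nonempty (L ≃ₗ[S] LinearMap.range f.dualMap)

/-- `M` and `N` are linked by the ideal `c`: both are annihilated by `c` (hence are
`R/c`-modules) and `M ≅ λ_{R/c} N`, `N ≅ λ_{R/c} M`. -/
def LinkedBy (c : Ideal R) (M N : Type u) [AddCommGroup M] [Module (R ⧸ c) M]
    [AddCommGroup N] [Module (R ⧸ c) N] [IsLocalRing (R ⧸ c)] : Prop :=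
  IsLambdaOf (R ⧸ c) N M ∧ IsLambdaOf (R ⧸ c) M N

/-- Vanishing of `Ext^j_A(X, Y)`. -/
def EV (A : Type) [CommRing A] (X Y : Type) [AddCommGroup X] [Module A X] [AddCommGroup Y]
    [Module A Y] (j : ℕ) : Prop :=
  Subsingleton (Abelian.Ext.{0} (ModuleCat.of A X) (ModuleCat.of A Y) j)

section EVapi
variable {A : Type} [CommRing A]
variable {X X' X'' Y Y' Y'' : Type} [AddCommGroup X] [Module A X] [AddCommGroup X'] [Module A X']
  [AddCommGroup X''] [Module A X''] [AddCommGroup Y] [Module A Y] [AddCommGroup Y'] [Module A Y']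
  [AddCommGroup Y''] [Module A Y'']

lemma sesOf (f : X' →ₗ[A] X) (g : X →ₗ[A] X'') (hf : Function.Injective f)
    (hfg : Function.Exact f g) (hg : Function.Surjective g) :
    (ShortComplex.mk (ModuleCat.ofHom f) (ModuleCat.ofHom g)
      (by ext x; exact hfg.apply_apply_eq_zero x)).ShortExact :=
  { exact := (ShortComplex.moduleCat_exact_iff _).2 fun x hx => (hfg x).1 hx
    mono_f := (ModuleCat.mono_iff_injective _).2 hf
    epi_g := (ModuleCat.epi_iff_surjective _).2 hg }

lemma EV.def' {j : ℕ} (h : ∀ e : Abelian.Ext.{0} (ModuleCat.of A X) (ModuleCat.of A Y) j, e = 0) :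
    EV A X Y j := ⟨fun a b => by rw [h a, h b]⟩

lemma EV.eq_zero {j : ℕ} (h : EV A X Y j)
    (e : Abelian.Ext.{0} (ModuleCat.of A X) (ModuleCat.of A Y) j) : e = 0 :=
  h.elim _ _

lemma EV.zero_iff : EV A X Y 0 ↔ ∀ f : X →ₗ[A] Y, f = 0 := by
  constructor
  · intro h f
    have := h.eq_zero (Abelian.Ext.mk₀ (ModuleCat.ofHom f))
    rw [Abelian.Ext.mk₀_eq_zero_iff] at this
    exact congrArg ModuleCat.Hom.hom this
  · intro h
    refine EV.def' fun e => ?_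
    obtain ⟨f, rfl⟩ := Abelian.Ext.homEquiv₀.symm.surjective e
    have : f = 0 := ModuleCat.hom_ext (h f.hom)
    subst this; simp

lemma EV.of_projective [Module.Projective A X] (j : ℕ) : EV A X Y (j+1) :=
  EV.def' fun e => Abelian.Ext.eq_zero_of_projective e

lemma EV.of_injective (h : Injective (ModuleCat.of A Y)) (j : ℕ) : EV A X Y (j+1) :=
  EV.def' fun e => Abelian.Ext.eq_zero_of_injective e

lemma EV.of_subsingleton_left [Subsingleton X] (j : ℕ) : EV A X Y j := by
  cases j with
  | zero => exact EV.zero_iff.2 fun f => by ext x; rw [Subsingleton.elim x 0]; simp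
  | succ j => exact EV.of_projective j

lemma EV.of_retract_left {j : ℕ} (i : X →ₗ[A] X') (p : X' →ₗ[A] X) (h : p ∘ₗ i = LinearMap.id)
    (hX : EV A X' Y j) : EV A X Y j := by
  refine EV.def' fun e => ?_
  have h1 : ModuleCat.ofHom i ≫ ModuleCat.ofHom p = 𝟙 _ := by
    rw [← ModuleCat.ofHom_comp, h]; rfl
  rw [← Abelian.Ext.mk₀_id_comp e, ← h1, ← Abelian.Ext.mk₀_comp_mk₀]
  rw [Abelian.Ext.comp_assoc_of_second_deg_zero,
    hX.eq_zero ((Abelian.Ext.mk₀ (ModuleCat.ofHom p)).comp e (zero_add j)), Abelian.Ext.comp_zero]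

lemma EV.of_retract_right {j : ℕ} (i : Y →ₗ[A] Y') (p : Y' →ₗ[A] Y) (h : p ∘ₗ i = LinearMap.id)
    (hX : EV A X Y' j) : EV A X Y j := by
  refine EV.def' fun e => ?_
  have h1 : ModuleCat.ofHom i ≫ ModuleCat.ofHom p = 𝟙 _ := by
    rw [← ModuleCat.ofHom_comp, h]; rfl
  rw [← Abelian.Ext.comp_mk₀_id e, ← h1, ← Abelian.Ext.mk₀_comp_mk₀]
  rw [← Abelian.Ext.comp_assoc_of_second_deg_zero,
    hX.eq_zero (e.comp (Abelian.Ext.mk₀ (ModuleCat.ofHom i)) (add_zero j)), Abelian.Ext.zero_comp]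

lemma EV.congr_left {j : ℕ} (e : X ≃ₗ[A] X') : EV A X Y j ↔ EV A X' Y j :=
  ⟨EV.of_retract_left e.symm.toLinearMap e.toLinearMap (by ext; simp),
   EV.of_retract_left e.toLinearMap e.symm.toLinearMap (by ext; simp)⟩

lemma EV.congr_right {j : ℕ} (e : Y ≃ₗ[A] Y') : EV A X Y j ↔ EV A X Y' j :=
  ⟨EV.of_retract_right e.symm.toLinearMap e.toLinearMap (by ext; simp),
   EV.of_retract_right e.toLinearMap e.symm.toLinearMap (by ext; simp)⟩

section left
variable {f : X' →ₗ[A] X} {g : X →ₗ[A] X''} (hf : Function.Injective f)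
    (hfg : Function.Exact f g) (hg : Function.Surjective g)
include hf hfg hg

lemma EV.left₂ {j : ℕ} (h1 : EV A X' Y j) (h3 : EV A X'' Y j) : EV A X Y j := by
  refine EV.def' fun e => ?_
  obtain ⟨y, rfl⟩ := Abelian.Ext.contravariant_sequence_exact₂ (sesOf f g hf hfg hg) _ e
    (h1.eq_zero _)
  rw [EV.eq_zero h3 y, Abelian.Ext.comp_zero]

lemma EV.left₁ {j : ℕ} (h2 : EV A X Y j) (h3 : EV A X'' Y (j+1)) : EV A X' Y j := by
  refine EV.def' fun e => ?_
  obtain ⟨y, rfl⟩ := Abelian.Ext.contravariant_sequence_exact₁ (sesOf f g hf hfg hg) _ e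
    (add_comm 1 j) (h3.eq_zero _)
  rw [EV.eq_zero h2 y, Abelian.Ext.comp_zero]

lemma EV.left₃ {j : ℕ} (h1 : EV A X' Y j) (h2 : EV A X Y (j+1)) : EV A X'' Y (j+1) := by
  refine EV.def' fun e => ?_
  obtain ⟨y, rfl⟩ := Abelian.Ext.contravariant_sequence_exact₃ (sesOf f g hf hfg hg) _ e
    (h2.eq_zero _) (add_comm 1 j)
  rw [EV.eq_zero h1 y, Abelian.Ext.comp_zero]

lemma EV.left_zero (h2 : EV A X Y 0) : EV A X'' Y 0 := by
  rw [EV.zero_iff] at *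
  intro φ
  ext x
  obtain ⟨x, rfl⟩ := hg x
  exact LinearMap.congr_fun (h2 (φ ∘ₗ g)) x

/-- Extension of maps when the first Ext vanishes. -/
lemma EV.extend (h : EV A X'' Y 1) (φ : X' →ₗ[A] Y) : ∃ ψ : X →ₗ[A] Y, ψ ∘ₗ f = φ := by
  obtain ⟨y, hy⟩ := Abelian.Ext.contravariant_sequence_exact₁ (sesOf f g hf hfg hg) _
    (Abelian.Ext.mk₀ (ModuleCat.ofHom φ)) (add_comm 1 0) (h.eq_zero _)
  obtain ⟨ψ, rfl⟩ := Abelian.Ext.homEquiv₀.symm.surjective y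
  refine ⟨ψ.hom, ?_⟩
  simp only [Abelian.Ext.homEquiv₀_symm_apply, Abelian.Ext.mk₀_comp_mk₀] at hy
  exact congrArg ModuleCat.Hom.hom (Abelian.Ext.homEquiv₀.symm.injective hy)

lemma EV.one_of_extend (h2 : EV A X Y 1) (h : ∀ φ : X' →ₗ[A] Y, ∃ ψ : X →ₗ[A] Y, ψ ∘ₗ f = φ) :
    EV A X'' Y 1 := by
  refine EV.def' fun e => ?_
  obtain ⟨y, rfl⟩ := Abelian.Ext.contravariant_sequence_exact₃ (sesOf f g hf hfg hg) _ e
    (h2.eq_zero _) (add_comm 1 0)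
  obtain ⟨φ, rfl⟩ := Abelian.Ext.homEquiv₀.symm.surjective y
  obtain ⟨ψ, hψ⟩ := h φ.hom
  have : φ = ModuleCat.ofHom f ≫ ModuleCat.ofHom ψ := by
    ext x; exact (LinearMap.congr_fun hψ x).symm
  subst this
  simp only [Abelian.Ext.homEquiv₀_symm_apply]
  rw [← Abelian.Ext.mk₀_comp_mk₀, (sesOf f g hf hfg hg).extClass_comp_assoc]
end left

section right
variable {f : Y' →ₗ[A] Y} {g : Y →ₗ[A] Y''} (hf : Function.Injective f)
    (hfg : Function.Exact f g) (hg : Function.Surjective g)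
include hf hfg hg

lemma EV.right₂ {j : ℕ} (h1 : EV A X Y' j) (h3 : EV A X Y'' j) : EV A X Y j := by
  refine EV.def' fun e => ?_
  obtain ⟨y, rfl⟩ := Abelian.Ext.covariant_sequence_exact₂ _ (sesOf f g hf hfg hg) e
    (h3.eq_zero _)
  rw [EV.eq_zero h1 y, Abelian.Ext.zero_comp]

lemma EV.right₁ {j : ℕ} (h3 : EV A X Y'' j) (h2 : EV A X Y (j+1)) : EV A X Y' (j+1) := by
  refine EV.def' fun e => ?_
  obtain ⟨y, rfl⟩ := Abelian.Ext.covariant_sequence_exact₁ _ (sesOf f g hf hfg hg) e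
    (h2.eq_zero _) rfl
  rw [EV.eq_zero h3 y, Abelian.Ext.zero_comp]

lemma EV.right₃ {j : ℕ} (h2 : EV A X Y j) (h1 : EV A X Y' (j+1)) : EV A X Y'' j := by
  refine EV.def' fun e => ?_
  obtain ⟨y, rfl⟩ := Abelian.Ext.covariant_sequence_exact₃ _ (sesOf f g hf hfg hg) e
    rfl (h1.eq_zero _)
  rw [EV.eq_zero h2 y, Abelian.Ext.zero_comp]

lemma EV.lift (h : EV A X Y' 1) (φ : X →ₗ[A] Y'') : ∃ ψ : X →ₗ[A] Y, g ∘ₗ ψ = φ := by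
  obtain ⟨y, hy⟩ := Abelian.Ext.covariant_sequence_exact₃ _ (sesOf f g hf hfg hg)
    (Abelian.Ext.mk₀ (ModuleCat.ofHom φ)) rfl (h.eq_zero _)
  obtain ⟨ψ, rfl⟩ := Abelian.Ext.homEquiv₀.symm.surjective y
  refine ⟨ψ.hom, ?_⟩
  simp only [Abelian.Ext.homEquiv₀_symm_apply, Abelian.Ext.mk₀_comp_mk₀] at hy
  exact congrArg ModuleCat.Hom.hom (Abelian.Ext.homEquiv₀.symm.injective hy)
end right

lemma piSES (k : ℕ) (Z : Type) [AddCommGroup Z] [Module A Z] :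
    Function.Injective (LinearMap.single A (fun _ : Fin (k+1) => Z) 0) ∧
    Function.Exact (LinearMap.single A (fun _ : Fin (k+1) => Z) 0)
      (LinearMap.funLeft A Z (Fin.succ : Fin k → Fin (k+1))) ∧
    Function.Surjective (LinearMap.funLeft A Z (Fin.succ : Fin k → Fin (k+1))) := by
  refine ⟨fun a b h => by simpa using congrFun h 0, ?_, ?_⟩
  · intro x
    constructor
    · intro h
      refine ⟨x 0, ?_⟩
      ext i
      refine Fin.cases ?_ (fun i => ?_) i
      · simp
      · have := congrFun h i
        simp [LinearMap.funLeft_apply] at this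
        simp [this]
    · rintro ⟨y, rfl⟩
      ext i
      simp [LinearMap.funLeft_apply]
  · intro x
    exact ⟨Fin.cons 0 x, by ext i; simp [LinearMap.funLeft_apply]⟩

lemma EV.pi_left {j : ℕ} (h : EV A X Y j) (k : ℕ) : EV A (Fin k → X) Y j := by
  induction k with
  | zero => exact EV.of_subsingleton_left j
  | succ k ih =>
    obtain ⟨h1, h2, h3⟩ := piSES (A := A) k X
    exact EV.left₂ h1 h2 h3 h ih

lemma EV.of_subsingleton_right [Subsingleton Y] (j : ℕ) : EV A X Y j := by
  cases j with
  | zero => exact EV.zero_iff.2 fun f => by ext x; exact Subsingleton.elim _ _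
  | succ j => 
    refine EV.of_injective ?_ j
    exact (ModuleCat.isZero_of_subsingleton (ModuleCat.of A Y)).injective

lemma EV.pi_right {j : ℕ} (h : EV A X Y j) (k : ℕ) : EV A X (Fin k → Y) j := by
  induction k with
  | zero => exact EV.of_subsingleton_right j
  | succ k ih =>
    obtain ⟨h1, h2, h3⟩ := piSES (A := A) k Y
    exact EV.right₂ h1 h2 h3 h ih

/-- A chosen syzygy. -/
lemma exists_syz (A : Type) [CommRing A] [IsNoetherianRing A] (X : Type) [AddCommGroup X] [Module A X]
    [Module.Finite A X] : ∃ (b : ℕ) (g : (Fin b → A) →ₗ[A] X), Function.Surjective g :=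
  Module.Finite.exists_fin' A X

end EVapi

/-- `Ext^j(X, A) = 0` for all `X` and all `j > d`. -/
def GorD (A : Type) [CommRing A] (d : ℕ) : Prop :=
  ∀ (X : Type) [AddCommGroup X] [Module A X] (j : ℕ), d < j → EV A X A j

section Bidual
variable {A : Type} [CommRing A] [IsNoetherianRing A]

lemma dual_ses {X : Type} [AddCommGroup X] [Module A X] {Y : Type} [AddCommGroup Y] [Module A Y]
    {F : Type} [AddCommGroup F] [Module A F]
    (g : F →ₗ[A] X) (hg : Function.Surjective g) (hX : EV A X Y 1) :
    Function.Injective (LinearMap.lcomp A Y g) ∧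
    Function.Exact (LinearMap.lcomp A Y g) (LinearMap.lcomp A Y (LinearMap.ker g).subtype) ∧
    Function.Surjective (LinearMap.lcomp A Y (LinearMap.ker g).subtype) := by
  refine ⟨?_, ?_, ?_⟩
  · intro a b h
    ext x
    obtain ⟨x, rfl⟩ := hg x
    exact LinearMap.congr_fun h x
  · intro φ
    constructor
    · intro h
      have hk : LinearMap.ker g ≤ LinearMap.ker φ := fun x hx => LinearMap.congr_fun h ⟨x, hx⟩
      refine ⟨((LinearMap.ker g).liftQ φ hk) ∘ₗ (g.quotKerEquivOfSurjective hg).symm.toLinearMap, ?_⟩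
      ext x
      have : (g.quotKerEquivOfSurjective hg).symm (g x) = Submodule.Quotient.mk x := by
        rw [LinearEquiv.symm_apply_eq]; rfl
      simp [this]
    · rintro ⟨ψ, rfl⟩
      ext x
      have : g x = 0 := x.2
      simp [this]
  · intro φ
    obtain ⟨ψ, hψ⟩ := EV.extend (Submodule.subtype_injective _) (LinearMap.exact_subtype_ker_map g) hg hX φ
    exact ⟨ψ, hψ⟩

lemma EV.ker {X Y F : Type} [AddCommGroup X] [Module A X] [AddCommGroup Y] [Module A Y]
    [AddCommGroup F] [Module A F] (g : F →ₗ[A] X) (hg : Function.Surjective g) {j : ℕ}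
    (h2 : EV A F Y j) (h3 : EV A X Y (j+1)) : EV A (LinearMap.ker g) Y j :=
  EV.left₁ (Submodule.subtype_injective _) (LinearMap.exact_subtype_ker_map g) hg h2 h3

lemma EV.of_ker {X Y F : Type} [AddCommGroup X] [Module A X] [AddCommGroup Y] [Module A Y]
    [AddCommGroup F] [Module A F] (g : F →ₗ[A] X) (hg : Function.Surjective g) {j : ℕ}
    (h2 : EV A F Y (j+1)) (h3 : EV A (LinearMap.ker g) Y j) : EV A X Y (j+1) :=
  EV.left₃ (Submodule.subtype_injective _) (LinearMap.exact_subtype_ker_map g) hg h3 h2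

lemma EV.dual {d : ℕ} (hd : GorD A d) (m : ℕ) : ∀ (X : Type) [AddCommGroup X] [Module A X]
    [Module.Finite A X] (_ : ∀ j, EV A X A (j+1)) (j : ℕ), d ≤ j + m →
      EV A (X →ₗ[A] A) A (j+1) := by
  induction m with
  | zero =>
    intro X _ _ _ hX j hj
    exact hd _ _ (by omega)
  | succ m ih =>
    intro X _ _ _ hX j hj
    obtain ⟨b, g, hg⟩ := exists_syz A X
    obtain ⟨h1, h2, h3⟩ := dual_ses (Y := A) g hg (hX 0)
    have hK : ∀ j, EV A (LinearMap.ker g) A (j+1) :=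
      fun j => EV.ker g hg (EV.of_projective j) (hX (j+1))
    refine EV.left₁ h1 h2 h3 ?_ (ih _ hK (j+1) (by omega))
    exact EV.of_projective j

lemma EV.dual' {d : ℕ} (hd : GorD A d) (X : Type) [AddCommGroup X] [Module A X]
    [Module.Finite A X] (hX : ∀ j, EV A X A (j+1)) (j : ℕ) : EV A (X →ₗ[A] A) A (j+1) :=
  EV.dual hd d X hX j (by omega)

lemma eval_surj {d : ℕ} (hd : GorD A d) (X : Type) [AddCommGroup X] [Module A X]
    [Module.Finite A X] (hX : ∀ j, EV A X A (j+1)) :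
    ∀ Φ : (X →ₗ[A] A) →ₗ[A] A, ∃ x, ∀ φ, Φ φ = φ x := by
  intro Φ
  obtain ⟨b, g, hg⟩ := exists_syz A X
  obtain ⟨h1, h2, h3⟩ := dual_ses (Y := A) g hg (hX 0)
  have hK : ∀ j, EV A (LinearMap.ker g) A (j+1) :=
    fun j => EV.ker g hg (EV.of_projective j) (hX (j+1))
  obtain ⟨Ψ, hΨ⟩ := EV.extend h1 h2 h3 (EV.dual' hd _ hK 0) Φ
  obtain ⟨a, ha⟩ := (Module.bijective_dual_eval A (Fin b → A)).2 Ψ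
  refine ⟨g a, fun φ => ?_⟩
  rw [← hΨ, ← ha]; rfl

lemma eval_inj {d : ℕ} (hd : GorD A d) (X : Type) [AddCommGroup X] [Module A X]
    [Module.Finite A X] (hX : ∀ j, EV A X A (j+1)) (x : X) (hx : ∀ φ : X →ₗ[A] A, φ x = 0) :
    x = 0 := by
  obtain ⟨b, g, hg⟩ := exists_syz A X
  obtain ⟨h1, h2, h3⟩ := dual_ses (Y := A) g hg (hX 0)
  have hK : ∀ j, EV A (LinearMap.ker g) A (j+1) :=
    fun j => EV.ker g hg (EV.of_projective j) (hX (j+1))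
  obtain ⟨a, rfl⟩ := hg x
  -- evaluation at `a` descends to the dual of the kernel
  let Φ : ((LinearMap.ker g) →ₗ[A] A) → A := fun φ => (h3 φ).choose a
  have key : ∀ ψ : (Fin b → A) →ₗ[A] A, ∀ ψ' : (Fin b → A) →ₗ[A] A,
      LinearMap.lcomp A A (LinearMap.ker g).subtype ψ = LinearMap.lcomp A A (LinearMap.ker g).subtype ψ'
        → ψ a = ψ' a := by
    intro ψ ψ' h
    have : LinearMap.lcomp A A (LinearMap.ker g).subtype (ψ - ψ') = 0 := by
      rw [map_sub, h, sub_self]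
    obtain ⟨θ, hθ⟩ := (h2 _).1 this
    have := LinearMap.congr_fun hθ a
    have h0 := hx θ
    simp only [LinearMap.lcomp_apply, h0, LinearMap.sub_apply] at this
    exact (sub_eq_zero.1 this.symm)
  let Φ' : ((LinearMap.ker g) →ₗ[A] A) →ₗ[A] A :=
    { toFun := Φ
      map_add' := fun φ φ' => by
        change (h3 (φ + φ')).choose a = ((h3 φ).choose + (h3 φ').choose) a
        apply key
        rw [map_add, (h3 _).choose_spec, (h3 _).choose_spec, (h3 _).choose_spec]
      map_smul' := fun r φ => by
        change (h3 (r • φ)).choose a = (r • (h3 φ).choose) a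
        apply key
        rw [map_smul, (h3 _).choose_spec, (h3 _).choose_spec] }
  obtain ⟨k, hk⟩ := eval_surj hd _ hK Φ'
  have : a = k := by
    apply (Module.bijective_dual_eval A (Fin b → A)).1
    ext1 ψ
    change ψ a = ψ k
    have h5 := hk (LinearMap.lcomp A A (LinearMap.ker g).subtype ψ)
    have h6 : (h3 (LinearMap.lcomp A A (LinearMap.ker g).subtype ψ)).choose a = ψ a :=
      key _ _ (h3 _).choose_spec
    rw [← h6]; exact h5
  rw [this]; exact k.2
end Bidual

section Nak
variable {S : Type} [CommRing S] [IsLocalRing S] [IsNoetherianRing S]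

lemma free_of_EV {ω : Type} [AddCommGroup ω] [Module S ω] [Module.Finite S ω] [Nontrivial ω]
    {Z : Type} [AddCommGroup Z] [Module S Z] {b : ℕ} (g : (Fin b → S) →ₗ[S] Z)
    (hg : Function.Surjective g) [Module.Projective S (LinearMap.ker g)] (h : EV S Z ω 1) :
    Module.Free S Z := by
  open TensorProduct in
  -- a surjection from `ω` to the residue field
  have hq : ∃ q : ω →ₗ[S] IsLocalRing.ResidueField S, Function.Surjective q := by
    have hnt : Nontrivial (IsLocalRing.ResidueField S ⊗[S] ω) := by
      rw [← not_subsingleton_iff_nontrivial, IsLocalRing.subsingleton_tensorProduct,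
        not_subsingleton_iff_nontrivial]; infer_instance
    obtain ⟨t, ht⟩ := exists_ne (0 : IsLocalRing.ResidueField S ⊗[S] ω)
    obtain ⟨l, hl⟩ : ∃ l : Module.Dual (IsLocalRing.ResidueField S)
        (IsLocalRing.ResidueField S ⊗[S] ω), l t ≠ 0 := by
      by_contra! hc
      exact ht ((Module.forall_dual_apply_eq_zero_iff _ _).1 hc)
    let q : ω →ₗ[S] IsLocalRing.ResidueField S :=
      (l.restrictScalars S) ∘ₗ (TensorProduct.mk S (IsLocalRing.ResidueField S) ω 1)
    have hq0 : ∃ w, q w ≠ 0 := by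
      by_contra! hc
      apply hl
      have : l = 0 := by
        ext w
        exact hc w
      rw [this]; rfl
    obtain ⟨w, hw⟩ := hq0
    refine ⟨q, fun x => ?_⟩
    obtain ⟨s, hs⟩ := IsLocalRing.residue_surjective (x / q w)
    refine ⟨s • w, ?_⟩
    rw [map_smul, Algebra.smul_def]
    change IsLocalRing.residue S s * _ = _
    rw [hs, div_mul_cancel₀ _ hw]
  obtain ⟨q, hq⟩ := hq
  refine Module.free_of_lTensor_residueField_injective (LinearMap.ker g).subtype g hg
    (LinearMap.exact_subtype_ker_map g) ?_
  rw [← LinearMap.ker_eq_bot, LinearMap.ker_eq_bot']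
  intro t ht
  rw [← Module.forall_dual_apply_eq_zero_iff (IsLocalRing.ResidueField S)]
  intro l
  let l₀ : (LinearMap.ker g) →ₗ[S] IsLocalRing.ResidueField S :=
    (l.restrictScalars S) ∘ₗ (TensorProduct.mk S (IsLocalRing.ResidueField S) _ 1)
  obtain ⟨l₁, hl₁⟩ := Module.projective_lifting_property q l₀ hq
  obtain ⟨l₂, hl₂⟩ := EV.extend (Submodule.subtype_injective _) (LinearMap.exact_subtype_ker_map g) hg h l₁
  let l₃ : (Fin b → S) →ₗ[S] IsLocalRing.ResidueField S := q ∘ₗ l₂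
  have h3 : ∀ x : LinearMap.ker g, l₃ x = l₀ x := by
    intro x
    rw [← hl₁, ← hl₂]; rfl
  let L : TensorProduct S (IsLocalRing.ResidueField S) (Fin b → S) →ₗ[S] IsLocalRing.ResidueField S :=
    TensorProduct.lift ((LinearMap.mul S (IsLocalRing.ResidueField S)).compl₂ l₃)
  have h5 : l.restrictScalars S = L ∘ₗ (LinearMap.lTensor _ (LinearMap.ker g).subtype) := by
    ext x y
    obtain ⟨s, rfl⟩ := IsLocalRing.residue_surjective x
    simp only [L, TensorProduct.AlgebraTensorModule.curry_apply, LinearMap.restrictScalars_self,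
      TensorProduct.curry_apply, LinearMap.coe_restrictScalars, LinearMap.coe_comp,
      Function.comp_apply, LinearMap.lTensor_tmul, TensorProduct.lift.tmul, LinearMap.compl₂_apply,
      LinearMap.mul_apply', Submodule.subtype_apply]
    rw [h3]
    have : (IsLocalRing.residue S s) ⊗ₜ[S] y = (IsLocalRing.residue S s) •
      ((1 : IsLocalRing.ResidueField S) ⊗ₜ[S] y) := by
      rw [TensorProduct.smul_tmul', smul_eq_mul, mul_one]
    rw [this, map_smul, smul_eq_mul]; rfl
  have := LinearMap.congr_fun h5 t
  rw [LinearMap.comp_apply, ht, map_zero] at this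
  exact this
end Nak

section Omega
set_option linter.unusedSectionVars false
variable {S : Type} [CommRing S] [IsLocalRing S] [IsNoetherianRing S]
variable (S) (ω : Type) [AddCommGroup ω] [Module S ω]

/-- Modules which are reflexive with respect to `ω`. -/
structure ZC (Z : Type) [AddCommGroup Z] [Module S Z] : Prop where
  ev : ∀ j, EV S Z ω (j+1)
  evd : ∀ j, EV S (Z →ₗ[S] ω) ω (j+1)
  inj : ∀ z : Z, (∀ φ : Z →ₗ[S] ω, φ z = 0) → z = 0
  surj : ∀ Φ : (Z →ₗ[S] ω) →ₗ[S] ω, ∃ z, ∀ φ, Φ φ = φ z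

variable {S ω}

lemma ZC.free_surj (hs : ∀ h : ω →ₗ[S] ω, ∃ s : S, ∀ w, h w = s • w) (b : ℕ)
    (Φ : ((Fin b → S) →ₗ[S] ω) →ₗ[S] ω) : ∃ z, ∀ φ, Φ φ = φ z := by
  let e := (Pi.basisFun S (Fin b)).constr S (M' := ω)
  have h1 : ∀ i, ∃ s : S, ∀ w, Φ (e (Pi.single i w)) = s • w := by
    intro i
    exact hs (Φ ∘ₗ e.toLinearMap ∘ₗ LinearMap.single S (fun _ => ω) i)
  choose s hs using h1
  refine ⟨s, fun φ => ?_⟩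
  obtain ⟨w, rfl⟩ := e.surjective φ
  have h2 : w = ∑ i, Pi.single i (w i) := (Finset.univ_sum_single w).symm
  have h3 : e w s = ∑ i, s i • w i := by
    simp [e, Module.Basis.constr_apply_fintype]
  rw [h3]
  conv_lhs => rw [h2, map_sum, map_sum]
  simp only [hs]

lemma ZC.free_inj (hi : ∀ s : S, (∀ w : ω, s • w = 0) → s = 0) (b : ℕ)
    (z : Fin b → S) (h : ∀ φ : (Fin b → S) →ₗ[S] ω, φ z = 0) : z = 0 := by
  ext i
  refine hi _ fun w => ?_
  exact h ((LinearMap.toSpanSingleton S ω w) ∘ₗ (LinearMap.proj i))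

lemma EV.freeDual {X Y : Type} [AddCommGroup X] [Module S X] [AddCommGroup Y] [Module S Y] {j : ℕ}
    (h : EV S ω Y j) (b : ℕ) : EV S ((Fin b → S) →ₗ[S] ω) Y j :=
  (EV.congr_left ((Pi.basisFun S (Fin b)).constr S (M' := ω))).1 (EV.pi_left h b)

lemma EV.freeDual_right {X : Type} [AddCommGroup X] [Module S X] {j : ℕ}
    (h : EV S X ω j) (b : ℕ) : EV S X ((Fin b → S) →ₗ[S] ω) j :=
  (EV.congr_right ((Pi.basisFun S (Fin b)).constr S (M' := ω))).1 (EV.pi_right h b)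

lemma ZC.ker (hω : ∀ j, EV S ω ω (j+1)) (hs : ∀ h : ω →ₗ[S] ω, ∃ s : S, ∀ w, h w = s • w)
    (hi : ∀ s : S, (∀ w : ω, s • w = 0) → s = 0)
    {Z : Type} [AddCommGroup Z] [Module S Z] (hZ : ZC S ω Z) {b : ℕ} (g : (Fin b → S) →ₗ[S] Z)
    (hg : Function.Surjective g) : ZC S ω (LinearMap.ker g) := by
  obtain ⟨h1, h2, h3⟩ := dual_ses (Y := ω) g hg (hZ.ev 0)
  have hF : ∀ j, EV S ((Fin b → S) →ₗ[S] ω) ω (j+1) := fun j => EV.freeDual (X := ω) (hω j) b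
  refine ⟨fun j => EV.ker g hg (EV.of_projective j) (hZ.ev (j+1)), ?_, ?_, ?_⟩
  · intro j
    cases j with
    | zero =>
      refine EV.one_of_extend h1 h2 h3 (hF 0) fun Φ => ?_
      obtain ⟨z, hz⟩ := hZ.surj Φ
      obtain ⟨a, rfl⟩ := hg z
      refine ⟨LinearMap.applyₗ a, ?_⟩
      ext φ
      rw [hz]; rfl
    | succ j => exact EV.left₃ h1 h2 h3 (hZ.evd j) (hF (j+1))
  · intro z hz
    ext1
    refine ZC.free_inj hi b _ fun φ => hz (φ ∘ₗ (LinearMap.ker g).subtype)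
  · intro Φ
    obtain ⟨a, ha⟩ := ZC.free_surj hs b (Φ ∘ₗ LinearMap.lcomp S ω (LinearMap.ker g).subtype)
    have hga : g a = 0 := by
      refine hZ.inj _ fun φ => ?_
      have := ha (LinearMap.lcomp S ω g φ)
      rw [LinearMap.comp_apply, (h2 _).2 ⟨φ, rfl⟩, map_zero] at this
      exact this.symm
    refine ⟨⟨a, hga⟩, fun φ => ?_⟩
    obtain ⟨ψ, rfl⟩ := h3 φ
    exact ha ψ

lemma ZC.projective [Module.Finite S ω] [Nontrivial ω] (hω : ∀ j, EV S ω ω (j+1))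
    (hs : ∀ h : ω →ₗ[S] ω, ∃ s : S, ∀ w, h w = s • w)
    (hi : ∀ s : S, (∀ w : ω, s • w = 0) → s = 0) (d : ℕ) (m : ℕ) :
    ∀ (i : ℕ) (_ : d ≤ i + m) (Z : Type) [AddCommGroup Z] [Module S Z] [Module.Finite S Z]
      (_ : ZC S ω Z)
      (_ : ∀ (Y : Type) [AddCommGroup Y] [Module S Y], (∀ j, EV S Y ω (j+1)) → ∀ j, d < j + 1 + i →
        EV S Y (Z →ₗ[S] ω) (j+1)), Module.Projective S Z := by
  induction m with
  | zero =>
    intro i hi' Z _ _ _ hZ H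
    obtain ⟨b, g, hg⟩ := exists_syz S Z
    obtain ⟨h1, h2, h3⟩ := dual_ses (Y := ω) g hg (hZ.ev 0)
    have hK := ZC.ker hω hs hi hZ g hg
    have hsp := H _ hK.evd 0 (by omega)
    obtain ⟨ρ, hρ⟩ := EV.extend h1 h2 h3 hsp LinearMap.id
    have hex : ∀ z : Z, ∃ a : Fin b → S, ∀ φ, (ρ φ) z = φ a := fun z =>
      ZC.free_surj hs b ((LinearMap.applyₗ z) ∘ₗ ρ)
    choose s hsz using hex
    let s' : Z →ₗ[S] (Fin b → S) :=
      { toFun := s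
        map_add' := fun x y => by
          rw [← sub_eq_zero]
          refine ZC.free_inj hi b _ fun φ => ?_
          rw [map_sub, map_add, ← hsz, ← hsz, ← hsz, map_add, sub_self]
        map_smul' := fun r x => by
          rw [← sub_eq_zero]
          refine ZC.free_inj hi b _ fun φ => ?_
          rw [map_sub, map_smul, RingHom.id_apply, ← hsz, ← hsz, map_smul, sub_self] }
    refine Module.Projective.of_split s' g ?_
    ext z
    rw [← sub_eq_zero]
    refine hZ.inj _ fun φ => ?_
    have h5 := hsz z (LinearMap.lcomp S ω g φ)
    have h6 := LinearMap.congr_fun hρ φ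
    rw [LinearMap.comp_apply] at h6
    rw [h6] at h5
    change φ (g (s z) - z) = 0
    rw [map_sub, sub_eq_zero]
    exact h5.symm
  | succ m ih =>
    intro i hi' Z _ _ _ hZ H
    obtain ⟨b, g, hg⟩ := exists_syz S Z
    obtain ⟨h1, h2, h3⟩ := dual_ses (Y := ω) g hg (hZ.ev 0)
    have hK := ZC.ker hω hs hi hZ g hg
    have := ih (i+1) (by omega) (LinearMap.ker g) hK ?_
    · have := free_of_EV (ω := ω) g hg (hZ.ev 0)
      infer_instance
    · intro Y _ _ hY j hj
      exact EV.right₃ h1 h2 h3 (EV.freeDual_right (hY j) b) (H Y hY (j+1) (by omega))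

lemma omega_projective [Module.Finite S ω] [Nontrivial ω] {d : ℕ} (hd : GorD S d)
    (hω : ∀ j, EV S ω ω (j+1))
    (hs : ∀ h : ω →ₗ[S] ω, ∃ s : S, ∀ w, h w = s • w)
    (hi : ∀ s : S, (∀ w : ω, s • w = 0) → s = 0) : Module.Projective S ω := by
  have hbij : Function.Bijective (LinearMap.lsmul S ω) := by
    constructor
    · rw [← LinearMap.ker_eq_bot, LinearMap.ker_eq_bot']
      intro s h
      exact hi s fun w => LinearMap.congr_fun h w
    · intro h
      obtain ⟨s, hs⟩ := hs h
      exact ⟨s, by ext w; rw [hs]; rfl⟩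
  let e : S ≃ₗ[S] (ω →ₗ[S] ω) := LinearEquiv.ofBijective (LinearMap.lsmul S ω) hbij
  refine ZC.projective hω hs hi d d 0 (by omega) ω ⟨hω, ?_, ?_, ?_⟩ ?_
  · intro j
    exact (EV.congr_left e).1 (EV.of_projective j)
  · intro z hz; exact hz LinearMap.id
  · intro Φ
    refine ⟨Φ LinearMap.id, fun φ => ?_⟩
    obtain ⟨s, hs⟩ := hs φ
    have : φ = s • LinearMap.id := by ext w; rw [hs]; rfl
    rw [this, map_smul]; rfl
  · intro Y _ _ hY j hj
    exact (EV.congr_right e).1 (hd Y (j+1) (by omega))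
end Omega

section Trans
variable {A S : Type} [CommRing A] [CommRing S] [Algebra A S]

/-- The functor `Ext^g_A(-, Y)` on `S`-modules is represented by `W` through the class `c`. -/
def ExtRep (A S : Type) [CommRing A] [CommRing S] [Algebra A S] (W Y : Type) [AddCommGroup W]
    [Module A W] [AddCommGroup Y] [Module A Y] (g : ℕ)
    (c : Abelian.Ext.{0} (ModuleCat.of A W) (ModuleCat.of A Y) g) : Prop :=
  ∀ (X : Type) [AddCommGroup X] [Module A X] [Module S X] [IsScalarTower A S X],
    Function.Bijective (fun φ : X →ₗ[A] W =>
      (Abelian.Ext.mk₀ (ModuleCat.ofHom φ)).comp c (zero_add g))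

variable (hS : Function.Surjective (algebraMap A S))
variable {W Y : Type} [AddCommGroup W] [Module A W] [Module S W] [IsScalarTower A S W]
  [AddCommGroup Y] [Module A Y] {g : ℕ}
  {c : Abelian.Ext.{0} (ModuleCat.of A W) (ModuleCat.of A Y) g} (hc : ExtRep A S W Y g c)
variable {X F : Type} [AddCommGroup X] [Module A X] [Module S X] [IsScalarTower A S X]
   [AddCommGroup F] [Module A F] [Module S F] [IsScalarTower A S F]

include hS hc in
lemma ExtRep.zero : EV S X W 0 ↔ EV A X Y g := by
  constructor
  · intro h
    rw [EV.zero_iff] at h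
    refine EV.def' fun e => ?_
    obtain ⟨φ, rfl⟩ := (hc X).2 e
    have : φ = 0 := by
      ext x
      exact LinearMap.congr_fun (h (LinearMap.extendScalarsOfSurjective hS φ)) x
    subst this
    change (Abelian.Ext.mk₀ 0).comp c _ = 0
    simp
  · intro h
    rw [EV.zero_iff]
    intro φ
    have : φ.restrictScalars A = 0 := by
      apply (hc X).1
      exact h.elim _ _
    ext x
    exact LinearMap.congr_fun this x

include hS hc in
lemma ExtRep.one (p : F →ₗ[S] X) (hp : Function.Surjective p)
    (hF : EV S F W 1) (hF' : EV A F Y (g+1)) : EV S X W 1 ↔ EV A X Y (g+1) := by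
  have hex : Function.Exact ((LinearMap.ker p).subtype.restrictScalars A) (p.restrictScalars A) :=
    LinearMap.exact_subtype_ker_map p
  have hses := sesOf ((LinearMap.ker p).subtype.restrictScalars A) (p.restrictScalars A)
    (Submodule.subtype_injective _) hex hp
  constructor
  · intro h
    refine EV.def' fun e => ?_
    obtain ⟨y, rfl⟩ := Abelian.Ext.contravariant_sequence_exact₃ hses _ e
      (hF'.eq_zero _) (add_comm 1 g)
    obtain ⟨φ, rfl⟩ := (hc _).2 y
    obtain ⟨ψ, hψ⟩ := EV.extend (Submodule.subtype_injective _) (LinearMap.exact_subtype_ker_map p) hp h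
      (LinearMap.extendScalarsOfSurjective hS φ)
    have : φ = (ψ.restrictScalars A) ∘ₗ ((LinearMap.ker p).subtype.restrictScalars A) := by
      ext x
      exact (LinearMap.congr_fun hψ x).symm
    subst this
    dsimp only
    rw [ModuleCat.ofHom_comp, ← Abelian.Ext.mk₀_comp_mk₀]
    rw [Abelian.Ext.comp_assoc_of_second_deg_zero, hses.extClass_comp_assoc]
  · intro h
    refine EV.one_of_extend (Submodule.subtype_injective _) (LinearMap.exact_subtype_ker_map p) hp hF
      fun φ => ?_
    obtain ⟨z, hz⟩ := Abelian.Ext.contravariant_sequence_exact₁ hses _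
      ((Abelian.Ext.mk₀ (ModuleCat.ofHom (φ.restrictScalars A))).comp c (zero_add g))
      (add_comm 1 g) (h.eq_zero _)
    obtain ⟨ψ, rfl⟩ := (hc F).2 z
    have : (φ.restrictScalars A) =
        ψ ∘ₗ ((LinearMap.ker p).subtype.restrictScalars A) := by
      apply (hc _).1
      dsimp only
      rw [ModuleCat.ofHom_comp, ← Abelian.Ext.mk₀_comp_mk₀]
      rw [Abelian.Ext.comp_assoc_of_second_deg_zero]
      exact hz.symm
    refine ⟨LinearMap.extendScalarsOfSurjective hS ψ, ?_⟩
    ext x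
    exact (LinearMap.congr_fun this x).symm

lemma EV.ker_iff (p : F →ₗ[S] X) (hp : Function.Surjective p) {j : ℕ} (hF : EV A F Y (j+1))
    (hF' : EV A F Y (j+2)) : EV A X Y (j+2) ↔ EV A (LinearMap.ker p) Y (j+1) := by
  have hex : Function.Exact ((LinearMap.ker p).subtype.restrictScalars A) (p.restrictScalars A) :=
    LinearMap.exact_subtype_ker_map p
  exact ⟨fun h => EV.left₁ (f := (LinearMap.ker p).subtype.restrictScalars A)
      (Submodule.subtype_injective _) hex hp hF h,
    fun h => EV.left₃ (f := (LinearMap.ker p).subtype.restrictScalars A)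
      (Submodule.subtype_injective _) hex hp h hF'⟩

lemma EV.piA {j : ℕ} (h : EV A S Y j) (b : ℕ) : EV A (Fin b → S) Y j := EV.pi_left h b

include hS hc in
/-- Finitely generated version. -/
lemma ExtRep.fg [IsNoetherianRing S] (hY : ∀ j, EV A S Y (g+1+j)) (j : ℕ) :
    ∀ (X : Type) [AddCommGroup X] [Module A X] [Module S X] [IsScalarTower A S X]
      [Module.Finite S X], EV S X W j ↔ EV A X Y (j+g) := by
  induction j with
  | zero => intro X _ _ _ _ _; rw [zero_add]; exact ExtRep.zero hS hc
  | succ j ih =>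
    intro X _ _ _ _ _
    obtain ⟨b, p, hp⟩ := exists_syz S X
    have hF : ∀ j, EV A (Fin b → S) Y (g+1+j) := fun j => EV.piA (hY j) b
    cases j with
    | zero =>
      rw [show 0 + 1 + g = g + 1 by omega]
      exact ExtRep.one hS hc p hp (EV.of_projective 0) (hF 0)
    | succ j =>
      rw [show j + 1 + 1 + g = (j + g) + 2 by omega]
      rw [EV.ker_iff (A := S) p hp (EV.of_projective j) (EV.of_projective (j+1)),
        EV.ker_iff (A := A) p hp (by convert hF j using 1; omega) (by convert hF (j+1) using 1; omega), ih]
      rw [show j + 1 + g = j + g + 1 by omega]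

include hS hc in
/-- Version for all modules. -/
lemma ExtRep.all (hY : ∀ (X : Type) j, EV A (X →₀ S) Y (g+1+j)) (j : ℕ) :
    ∀ (X : Type) [AddCommGroup X] [Module A X] [Module S X] [IsScalarTower A S X],
      EV S X W j ↔ EV A X Y (j+g) := by
  induction j with
  | zero => intro X _ _ _ _; rw [zero_add]; exact ExtRep.zero hS hc
  | succ j ih =>
    intro X _ _ _ _
    have hp := Finsupp.linearCombination_id_surjective S X
    set p := Finsupp.linearCombination S (id : X → X)
    cases j with
    | zero =>
      rw [show 0 + 1 + g = g + 1 by omega]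
      exact ExtRep.one hS hc p hp (EV.of_projective 0) (hY X 0)
    | succ j =>
      rw [show j + 1 + 1 + g = (j + g) + 2 by omega]
      rw [EV.ker_iff (A := S) p hp (EV.of_projective j) (EV.of_projective (j+1)),
        EV.ker_iff (A := A) p hp (by convert hY X j using 1; omega) (by convert hY X (j+1) using 1; omega), ih]
      rw [show j + 1 + g = j + g + 1 by omega]
end Trans

section RegElt
variable {B : Type} [CommRing B] (x : B)

lemma reg_ses (hx : IsSMulRegular B x) :
    Function.Injective (LinearMap.lsmul B B x) ∧
    Function.Exact (LinearMap.lsmul B B x) (Submodule.mkQ (Ideal.span {x})) ∧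
    Function.Surjective (Submodule.mkQ (Ideal.span {x})) := by
  refine ⟨hx, ?_, Submodule.mkQ_surjective _⟩
  intro b
  rw [Submodule.mkQ_apply, Submodule.Quotient.mk_eq_zero, Ideal.mem_span_singleton']
  constructor
  · rintro ⟨a, rfl⟩; exact ⟨a, by simp [mul_comm]⟩
  · rintro ⟨a, rfl⟩; exact ⟨a, by simp [mul_comm]⟩

lemma reg_rep (hx : IsSMulRegular B x) :
    ExtRep B (B ⧸ Ideal.span {x}) (B ⧸ Ideal.span {x}) B 1
      (sesOf _ _ (reg_ses x hx).1 (reg_ses x hx).2.1 (reg_ses x hx).2.2).extClass := by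
  intro X _ _ _ _
  have hxX : ∀ y : X, x • y = 0 := by
    intro y
    rw [← algebraMap_smul (B ⧸ Ideal.span {x}) x y]
    have : algebraMap B (B ⧸ Ideal.span {x}) x = 0 :=
      Ideal.Quotient.eq_zero_iff_mem.2 (Ideal.mem_span_singleton_self x)
    rw [this, zero_smul]
  have hses := (sesOf _ _ (reg_ses x hx).1 (reg_ses x hx).2.1 (reg_ses x hx).2.2)
  constructor
  · intro φ φ' h
    have h0 : (Abelian.Ext.mk₀ (ModuleCat.ofHom (φ - φ'))).comp hses.extClass (zero_add 1) = 0 := by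
      have h1 : ModuleCat.ofHom φ = ModuleCat.ofHom (φ - φ') + ModuleCat.ofHom φ' := by
        ext z; simp
      dsimp only at h
      rw [h1, Abelian.Ext.mk₀_add, Abelian.Ext.add_comp] at h
      exact add_eq_right.1 h
    obtain ⟨y, hy⟩ := Abelian.Ext.covariant_sequence_exact₃ _ hses
      (Abelian.Ext.mk₀ (ModuleCat.ofHom (φ - φ'))) rfl h0
    obtain ⟨ψ, rfl⟩ := Abelian.Ext.homEquiv₀.symm.surjective y
    have hψ : ψ = 0 := by
      ext z
      apply hx
      change x • ψ.hom z = x • 0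
      rw [← map_smul, hxX, map_zero, smul_zero]
    subst hψ
    simp only [Abelian.Ext.homEquiv₀_symm_apply, Abelian.Ext.mk₀_zero, Abelian.Ext.zero_comp] at hy
    have := (Abelian.Ext.mk₀_eq_zero_iff _).1 hy.symm
    rw [← sub_eq_zero]
    exact congrArg ModuleCat.Hom.hom this
  · intro e
    have h0 : e.comp (Abelian.Ext.mk₀ (ModuleCat.ofHom (LinearMap.lsmul B B x))) (add_zero 1) = 0 := by
      have h1 : ModuleCat.ofHom (LinearMap.lsmul B B x) = x • 𝟙 (ModuleCat.of B B) := by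
        ext; simp
      have h2 : x • 𝟙 (ModuleCat.of B X) = 0 := by
        ext y; exact hxX y
      have h3 : x • e = 0 := by
        rw [← Abelian.Ext.mk₀_id_comp e, ← Abelian.Ext.smul_comp, ← Abelian.Ext.mk₀_smul, h2]
        simp
      rw [h1, Abelian.Ext.mk₀_smul, Abelian.Ext.comp_smul, Abelian.Ext.comp_mk₀_id, h3]
    obtain ⟨y, hy⟩ := Abelian.Ext.covariant_sequence_exact₁ _ hses e h0 (zero_add 1)
    obtain ⟨ψ, rfl⟩ := Abelian.Ext.homEquiv₀.symm.surjective y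
    exact ⟨ψ.hom, hy⟩

lemma reg_free (hx : IsSMulRegular B x) (X : Type) (j : ℕ) :
    EV B (X →₀ (B ⧸ Ideal.span {x})) B (1+1+j) := by
  obtain ⟨h1, h2, h3⟩ := reg_ses x hx
  have h1' : Function.Injective (Finsupp.mapRange.linearMap (α := X) (LinearMap.lsmul B B x)) :=
    Finsupp.mapRange_injective _ (map_zero _) h1
  have h3' : Function.Surjective (Finsupp.mapRange.linearMap (α := X) (Submodule.mkQ (Ideal.span {x}))) :=
    Finsupp.mapRange_surjective _ (map_zero _) h3
  have h2' : Function.Exact (Finsupp.mapRange.linearMap (α := X) (LinearMap.lsmul B B x))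
      (Finsupp.mapRange.linearMap (α := X) (Submodule.mkQ (Ideal.span {x}))) := by
    rw [LinearMap.exact_iff]
    rw [Finsupp.ker_mapRange, Finsupp.range_mapRange_linearMap _ (LinearMap.ker_eq_bot.2 h1)]
    congr 1
    funext _
    exact LinearMap.exact_iff.1 h2
  have := EV.left₃ (Y := B) h1' h2' h3' (EV.of_projective j) (EV.of_projective (j+1))
  convert this using 1
  omega

lemma reg_iff (hx : IsSMulRegular B x) (X : Type) [AddCommGroup X] [Module B X]
    [Module (B ⧸ Ideal.span {x}) X] [IsScalarTower B (B ⧸ Ideal.span {x}) X] (j : ℕ) :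
    EV (B ⧸ Ideal.span {x}) X (B ⧸ Ideal.span {x}) j ↔ EV B X B (j+1) :=
  ExtRep.all Ideal.Quotient.mk_surjective (reg_rep x hx) (reg_free x hx) j X

lemma reg_gorD (hx : IsSMulRegular B x) {d : ℕ} (hd : GorD B d) :
    GorD (B ⧸ Ideal.span {x}) d := by
  intro X _ _ j hj
  let _ : Module B X := Module.compHom X (algebraMap B (B ⧸ Ideal.span {x}))
  have : IsScalarTower B (B ⧸ Ideal.span {x}) X := IsScalarTower.of_algebraMap_smul fun _ _ => rfl
  exact (reg_iff x hx X j).2 (hd X (j+1) (by omega))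

lemma reg_zero (hx : IsSMulRegular B x) (X : Type) [AddCommGroup X] [Module B X]
    [Module (B ⧸ Ideal.span {x}) X] [IsScalarTower B (B ⧸ Ideal.span {x}) X] :
    EV B X B 0 := by
  have hxX : ∀ y : X, x • y = 0 := by
    intro y
    rw [← algebraMap_smul (B ⧸ Ideal.span {x}) x y]
    have : algebraMap B (B ⧸ Ideal.span {x}) x = 0 :=
      Ideal.Quotient.eq_zero_iff_mem.2 (Ideal.mem_span_singleton_self x)
    rw [this, zero_smul]
  rw [EV.zero_iff]
  intro ψ
  ext z
  apply hx
  change x • ψ z = x • 0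
  rw [← map_smul, hxX, map_zero, smul_zero]
end RegElt

section Coind
variable (A S : Type) [CommRing A] [CommRing S] [Algebra A S]

/-- The coinduced module `Hom_A(S, A)`. -/
def OmegaM : Type := S →ₗ[A] A

variable {A S} in
/-- The underlying linear map. -/
def OmegaM.fn (φ : OmegaM A S) : S →ₗ[A] A := φ

instance : AddCommGroup (OmegaM A S) := inferInstanceAs (AddCommGroup (S →ₗ[A] A))
instance : Module A (OmegaM A S) := inferInstanceAs (Module A (S →ₗ[A] A))
instance : SMul S (OmegaM A S) := ⟨fun s φ => LinearMap.comp φ.fn (LinearMap.mulLeft A s)⟩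

variable {A S} in
lemma OmegaM.hext {φ ψ : OmegaM A S} (h : ∀ t, φ.fn t = ψ.fn t) : φ = ψ := LinearMap.ext h

variable {A S} in
lemma OmegaM.smul_fn (s : S) (φ : OmegaM A S) (t : S) :
    (s • φ : OmegaM A S).fn t = φ.fn (s * t) := rfl

instance : Module S (OmegaM A S) where
  one_smul φ := OmegaM.hext fun t => congrArg φ.fn (one_mul t)
  mul_smul s s' φ := OmegaM.hext fun t => congrArg φ.fn (by ring : s * s' * t = s' * (s * t))
  smul_zero s := rfl
  smul_add s φ ψ := rfl
  add_smul s s' φ := OmegaM.hext fun t => by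
    change φ.fn ((s + s') * t) = φ.fn (s * t) + φ.fn (s' * t)
    rw [add_mul, LinearMap.map_add]
  zero_smul φ := OmegaM.hext fun t => by
    change φ.fn (0 * t) = 0
    rw [zero_mul, LinearMap.map_zero]

instance : IsScalarTower A S (OmegaM A S) :=
  IsScalarTower.of_algebraMap_smul fun a φ => OmegaM.hext fun t => by
    change φ.fn (algebraMap A S a * t) = a • φ.fn t
    rw [← Algebra.smul_def, LinearMap.map_smul]

/-- Evaluation at one. -/
def OmegaM.ev : OmegaM A S →ₗ[A] A := LinearMap.applyₗ (R := A) (M := S) (M₂ := A) (1 : S)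

lemma OmegaM.rep (hS : Function.Surjective (algebraMap A S)) :
    ExtRep A S (OmegaM A S) A 0 (Abelian.Ext.mk₀ (ModuleCat.ofHom (OmegaM.ev A S))) := by
  intro X _ _ _ _
  constructor
  · intro φ φ' h
    dsimp only at h
    rw [Abelian.Ext.mk₀_comp_mk₀, Abelian.Ext.mk₀_comp_mk₀] at h
    have h' := congrArg ModuleCat.Hom.hom (Abelian.Ext.homEquiv₀.symm.injective h)
    ext y
    refine OmegaM.hext fun s => ?_
    have h1 := LinearMap.congr_fun h' (s • y)
    have key : ∀ φ : X →ₗ[A] OmegaM A S, (OmegaM.ev A S) (φ (s • y)) = (φ y).fn s := by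
      intro φ
      have : φ (s • y) = s • φ y := (LinearMap.extendScalarsOfSurjective hS φ).map_smul s y
      rw [this]
      change (φ y).fn (s * 1) = _
      rw [mul_one]
    rw [← key φ, ← key φ']; exact h1
  · intro e
    obtain ⟨ψ, rfl⟩ := Abelian.Ext.homEquiv₀.symm.surjective e
    let Φ : X →ₗ[A] (S →ₗ[A] A) :=
      { toFun := fun y => ψ.hom ∘ₗ (LinearMap.toSpanSingleton S X y).restrictScalars A
        map_add' := fun y y' => by
          ext s
          change ψ.hom (s • (y + y')) = ψ.hom (s • y) + ψ.hom (s • y')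
          rw [smul_add, map_add]
        map_smul' := fun a y => by
          ext s
          change ψ.hom (s • (a • y)) = a • ψ.hom (s • y)
          rw [smul_comm, map_smul] }
    refine ⟨Φ, ?_⟩
    dsimp only
    rw [Abelian.Ext.mk₀_comp_mk₀]
    rw [Abelian.Ext.homEquiv₀_symm_apply]
    congr 1
    ext y
    change ψ.hom ((1 : S) • y) = ψ.hom y
    rw [one_smul]
end Coind

/-- Existence of a relative canonical module. -/
def HasCan (B S : Type) [CommRing B] [CommRing S] [Algebra B S] (g : ℕ) : Prop :=
  ∃ (ω : Type) (_ : AddCommGroup ω) (_ : Module S ω), Module.Finite S ω ∧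
    (∀ j, EV S ω ω (j+1)) ∧ (∀ h : ω →ₗ[S] ω, ∃ s : S, ∀ w, h w = s • w) ∧
    (∀ s : S, (∀ w : ω, s • w = 0) → s = 0) ∧
    ∀ (X : Type) [AddCommGroup X] [Module B X] [Module S X] [IsScalarTower B S X]
      [Module.Finite S X], (∀ i, i < g → EV B X B i) ∧ ∀ j, EV S X ω j ↔ EV B X B (j+g)

lemma hasCan_zero (B : Type) [CommRing B] [IsNoetherianRing B] {d : ℕ} (hd : GorD B d)
    (S : Type) [CommRing S] [Algebra B S] (hS : Function.Surjective (algebraMap B S))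
    (hE : ∀ j, EV B S B (j+1)) : HasCan B S 0 := by
  have : IsNoetherianRing S := isNoetherianRing_of_surjective B S (algebraMap B S) hS
  have : Module.Finite B S := Module.Finite.of_surjective (Algebra.linearMap B S) hS
  have hfin : Module.Finite B (OmegaM B S) := by
    refine Module.Finite.of_injective (OmegaM.ev B S) ?_
    intro φ ψ h
    refine OmegaM.hext fun t => ?_
    obtain ⟨b, rfl⟩ := hS t
    rw [Algebra.algebraMap_eq_smul_one, map_smul, map_smul]
    congr 1
  have hiff := ExtRep.fg hS (OmegaM.rep B S hS) (fun j => by rw [zero_add, add_comm]; exact hE j)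
  refine ⟨OmegaM B S, inferInstance, inferInstance,
    Module.Finite.of_restrictScalars_finite B S _, ?_, ?_, ?_, ?_⟩
  · intro j
    have := Module.Finite.of_restrictScalars_finite B S (OmegaM B S)
    rw [hiff]
    exact EV.dual' hd S hE j
  · intro h
    obtain ⟨s, hs⟩ := eval_surj hd S hE (OmegaM.ev B S ∘ₗ h.restrictScalars B)
    refine ⟨s, fun φ => OmegaM.hext fun t => ?_⟩
    have h1 := hs (t • φ : OmegaM B S)
    change (h (t • φ)).fn 1 = (t • φ).fn s at h1
    rw [map_smul, OmegaM.smul_fn, OmegaM.smul_fn, mul_one, mul_comm] at h1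
    rw [OmegaM.smul_fn, h1]
  · intro s h
    refine eval_inj hd S hE s fun φ => ?_
    let φ' : OmegaM B S := φ
    have h1 : (s • φ').fn 1 = (0 : OmegaM B S).fn 1 := by rw [h φ']
    rw [OmegaM.smul_fn, mul_one] at h1
    exact h1
  · intro X _ _ _ _ _
    exact ⟨fun i hi => absurd hi (by omega), fun j => hiff j X⟩

lemma exists_reg (B : Type) [CommRing B] [IsNoetherianRing B] 
    (S : Type) [CommRing S] [Algebra B S] [Nontrivial S] (hS : Function.Surjective (algebraMap B S))
    (hE : EV B S B 0) : ∃ x : B, IsSMulRegular B x ∧ algebraMap B S x = 0 := by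
  have : Module.Finite B S := Module.Finite.of_surjective (Algebra.linearMap B S) hS
  have hann : ∀ x ∈ Module.annihilator B S, algebraMap B S x = 0 := by
    intro x hx
    rw [Algebra.algebraMap_eq_smul_one]
    exact Module.mem_annihilator.1 hx 1
  obtain ⟨rs, h1, h2, h3⟩ := ModuleCat.exists_isRegular_of_exists_subsingleton_ext
    (Module.annihilator B S) 1 (ModuleCat.of B B) (by
      rw [lt_top_iff_ne_top]
      intro h
      rw [smul_eq_mul, Ideal.mul_top] at h
      have := hann 1 (by rw [h]; trivial)
      rw [map_one] at this
      exact one_ne_zero this) (ModuleCat.of B S) (Module.support_eq_zeroLocus)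
    (by intro i hi
        obtain rfl : i = 0 := by omega
        exact hE)
  obtain ⟨x, rfl⟩ := List.length_eq_one_iff.1 h1
  refine ⟨x, ?_, hann x (h2 x (by simp))⟩
  exact ((RingTheory.Sequence.isWeaklyRegular_singleton_iff B x).1 h3.toIsWeaklyRegular)

lemma hasCan (g : ℕ) : ∀ (B : Type) [CommRing B] [IsNoetherianRing B] {d : ℕ} (_ : GorD B d)
    (S : Type) [CommRing S] [Nontrivial S] [Algebra B S]
    (_ : Function.Surjective (algebraMap B S))
    (_ : ∀ i, i ≠ g → EV B S B i), HasCan B S g := by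
  induction g with
  | zero =>
    intro B _ _ d hd S _ _ _ hS hE
    exact hasCan_zero B hd S hS fun j => hE _ (by omega)
  | succ g ih =>
    intro B _ _ d hd S _ _ _ hS hE
    obtain ⟨x, hx, hx0⟩ := exists_reg B S hS (hE 0 (by omega))
    have hle : ∀ a ∈ Ideal.span {x}, algebraMap B S a = 0 := by
      intro a ha
      obtain ⟨b, rfl⟩ := Ideal.mem_span_singleton'.1 ha
      rw [map_mul, hx0, mul_zero]
    let _ : Algebra (B ⧸ Ideal.span {x}) S := (Ideal.Quotient.lift _ (algebraMap B S) hle).toAlgebra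
    have htow : IsScalarTower B (B ⧸ Ideal.span {x}) S :=
      IsScalarTower.of_algebraMap_eq fun _ => rfl
    have hS' : Function.Surjective (algebraMap (B ⧸ Ideal.span {x}) S) := by
      intro s
      obtain ⟨b, rfl⟩ := hS s
      exact ⟨Ideal.Quotient.mk _ b, rfl⟩
    obtain ⟨ω, i1, i2, h1, h2, h3, h4, h5⟩ := ih (B ⧸ Ideal.span {x}) (reg_gorD x hx hd) S hS' fun i hi =>
      (reg_iff x hx S i).2 (hE (i+1) (by omega))
    refine ⟨ω, i1, i2, h1, h2, h3, h4, ?_⟩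
    intro X _ _ _ _ _
    let _ : Module (B ⧸ Ideal.span {x}) X := Module.compHom X (algebraMap (B ⧸ Ideal.span {x}) S)
    have : IsScalarTower (B ⧸ Ideal.span {x}) S X := IsScalarTower.of_algebraMap_smul fun _ _ => rfl
    have : IsScalarTower B (B ⧸ Ideal.span {x}) X := IsScalarTower.of_algebraMap_smul fun b y =>
      algebraMap_smul S b y
    obtain ⟨h6, h7⟩ := h5 X
    refine ⟨fun i hi => ?_, fun j => ?_⟩
    · cases i with
      | zero => exact reg_zero x hx X
      | succ i => exact (reg_iff x hx X i).1 (h6 i (by omega))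
    · rw [h7 j, reg_iff x hx X]; rfl

/-- Main vanishing statement. -/
lemma main_vanish (B : Type) [CommRing B] [IsNoetherianRing B] {d : ℕ} (hd : GorD B d)
    (S : Type) [CommRing S] [IsLocalRing S] [Algebra B S] (hS : Function.Surjective (algebraMap B S))
    {e : ℕ} (he : GorD S e)
    {g : ℕ} (hE : ∀ i, i ≠ g → EV B S B i)
    (M : Type) [AddCommGroup M] [Module B M] [Module S M] [IsScalarTower B S M] [Module.Finite S M]
    {k : ℕ} (ι : M →ₗ[S] (Fin k → S)) (hι : Function.Injective ι)
    {n : ℕ} (hM : ∀ i, i ≠ n → EV B M B i) (j : ℕ) : EV S M S (j+1) := by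
  have : IsNoetherianRing S := isNoetherianRing_of_surjective B S (algebraMap B S) hS
  obtain ⟨ω, i1, i2, h1, h2, h3, h4, h5⟩ := hasCan g B hd S hS hE
  have hnt : Nontrivial ω := by
    by_contra hc
    rw [not_nontrivial_iff_subsingleton] at hc
    exact one_ne_zero (h4 1 fun w => Subsingleton.elim _ _)
  have := omega_projective he h2 h3 h4
  have := Module.free_of_flat_of_isLocalRing (R := S) (P := ω)
  -- `S` is a retract of `ω`
  obtain ⟨r, ⟨bs⟩⟩ : ∃ r : ℕ, Nonempty (ω ≃ₗ[S] (Fin r → S)) :=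
    ⟨_, ⟨(Module.finBasis S ω).equivFun⟩⟩
  have hr : 0 < r := by
    rcases Nat.eq_zero_or_pos r with rfl | h
    · exact absurd (bs.toEquiv.subsingleton) (not_subsingleton ω)
    · exact h
  have hret : ∀ j, EV S M ω j → EV S M S j := by
    intro j h
    refine EV.of_retract_right (bs.symm.toLinearMap ∘ₗ LinearMap.single S (fun _ => S) (⟨0, hr⟩ : Fin r))
      ((LinearMap.proj (⟨0, hr⟩ : Fin r)) ∘ₗ bs.toLinearMap) ?_ h
    ext; simp
  obtain ⟨h6, h7⟩ := h5 M
  by_cases hn : n = g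
  · subst hn
    exact hret _ ((h7 _).2 (hM _ (by omega)))
  · have h0 := hret 0 ((h7 0).2 (hM _ (by omega)))
    rw [EV.zero_iff] at h0
    have : Subsingleton M := by
      refine ⟨fun a b => hι ?_⟩
      ext i
      have := h0 (LinearMap.proj i ∘ₗ ι)
      have e1 := LinearMap.congr_fun this a
      have e2 := LinearMap.congr_fun this b
      exact e1.trans e2.symm
    exact EV.of_subsingleton_left _

section Bridge

lemma exactAt_yoneda_iff {A : Type} [CommRing A] {α : Type} [AddRightCancelSemigroup α] [One α]
    (T : ChainComplex (ModuleCat.{0} A) α)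
    (Y : ModuleCat.{0} A) (i j k : α) (h1 : i + 1 = j) (h2 : j + 1 = k) :
    (T.linearYonedaObj A Y).ExactAt j ↔
      ∀ h : T.X j ⟶ Y, T.d k j ≫ h = 0 → ∃ l : T.X i ⟶ Y, T.d j i ≫ l = h := by
  rw [HomologicalComplex.exactAt_iff' _ i j k
    ((ComplexShape.up α).prev_eq' h1) ((ComplexShape.up α).next_eq' h2),
    ShortComplex.moduleCat_exact_iff]
  rfl

lemma extMod_isZero_iff (A : Type) [CommRing A] (X Y : Type) [AddCommGroup X] [Module A X]
    [AddCommGroup Y] [Module A Y] (i : ℕ) :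
    IsZero (ExtMod A i (ModuleCat.of A X) (ModuleCat.of A Y)) ↔ EV A X Y i := by
  let P := projectiveResolution (ModuleCat.of A X)
  rw [(P.isoExt (R := A) i (ModuleCat.of A Y)).isZero_iff,
    ← HomologicalComplex.exactAt_iff_isZero_homology]
  cases i with
  | succ i =>
    rw [exactAt_yoneda_iff _ _ i (i+1) (i+2) rfl rfl]
    constructor
    · intro h
      refine EV.def' fun e => ?_
      obtain ⟨f, hf, rfl⟩ := P.extMk_surjective e (i+2) rfl
      rw [P.extMk_eq_zero_iff f (i+2) rfl hf i rfl]
      exact h f hf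
    · intro h f hf
      rw [← P.extMk_eq_zero_iff f (i+2) rfl hf i rfl]
      exact h.eq_zero _
  | zero =>
    rw [HomologicalComplex.exactAt_iff, ShortComplex.moduleCat_exact_iff, EV.zero_iff]
    have hd : (P.complex.linearYonedaObj A (ModuleCat.of A Y)).d
        ((ComplexShape.up ℕ).prev 0) 0 = 0 := by
      apply HomologicalComplex.shape
      simp
    let p : P.complex.X 0 ⟶ ModuleCat.of A X := P.π.f 0
    have hpe : Epi p := inferInstanceAs (Epi (P.π.f 0))
    have hdp : P.complex.d 1 0 ≫ p = 0 := P.complex_d_comp_π_f_zero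
    have hdesc : ∀ (x : P.complex.X 0 ⟶ ModuleCat.of A Y), P.complex.d 1 0 ≫ x = 0 →
        ∃ y : ModuleCat.of A X ⟶ ModuleCat.of A Y, p ≫ y = x := fun x hx =>
      ⟨P.exact₀.desc x hx, P.exact₀.g_desc x hx⟩
    clear_value p
    have hn : (ComplexShape.up ℕ).next 0 = 1 := (ComplexShape.up ℕ).next_eq' rfl
    constructor
    · intro h f
      obtain ⟨z, hz⟩ := h (p ≫ ModuleCat.ofHom f) (by
        change P.complex.d _ 0 ≫ _ = 0
        rw [hn, ← Category.assoc, hdp, zero_comp])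
      have h0 : p ≫ ModuleCat.ofHom f = 0 := by
        rw [← hz]
        change ((P.complex.linearYonedaObj A (ModuleCat.of A Y)).d
          ((ComplexShape.up ℕ).prev 0) 0).hom z = 0
        rw [hd]; rfl
      have h1 : ModuleCat.ofHom f = 0 := by
        rw [← cancel_epi p, h0, comp_zero]
      exact congrArg ModuleCat.Hom.hom h1
    · intro h x hx
      let x' : P.complex.X 0 ⟶ ModuleCat.of A Y := x
      have hx' : P.complex.d 1 0 ≫ x' = 0 := by
        rw [← hn]; exact hx
      obtain ⟨y, hy⟩ := hdesc x' hx'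
      have hy0 : y = 0 := ModuleCat.hom_ext (h _)
      refine ⟨0, ?_⟩
      rw [map_zero]
      change (0 : P.complex.X 0 ⟶ ModuleCat.of A Y) = x'
      rw [← hy, hy0, comp_zero]

lemma res_left {A : Type} [CommRing A] {Y : Type} [AddCommGroup Y] [Module A Y] (n : ℕ) :
    ∀ (X : Type) [AddCommGroup X] [Module A X] (G : ℕ → Type) [∀ i, AddCommGroup (G i)]
      [∀ i, Module A (G i)] (d : ∀ i, G (i+1) →ₗ[A] G i) (ε : G 0 →ₗ[A] X)
      (_ : ∀ i j, EV A (G i) Y (j+1)) (_ : ∀ i, n < i → Subsingleton (G i))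
      (_ : Function.Surjective ε) (_ : Function.Exact (d 0) ε)
      (_ : ∀ i, Function.Exact (d (i+1)) (d i)) (j : ℕ), n < j → EV A X Y j := by
  induction n with
  | zero =>
    intro X _ _ G _ _ d ε hG hz hs h0 h1 j hj
    obtain ⟨j, rfl⟩ : ∃ k, j = k + 1 := ⟨j - 1, by omega⟩
    have hz1 := hz 1 (by omega)
    have : Subsingleton (LinearMap.ker ε) := by
      refine ⟨fun a b => ?_⟩
      obtain ⟨a', ha⟩ := (h0 a).1 a.2
      obtain ⟨b', hb⟩ := (h0 b).1 b.2
      ext1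
      rw [← ha, ← hb, Subsingleton.elim a' b']
    exact EV.left₃ (Submodule.subtype_injective _) (LinearMap.exact_subtype_ker_map ε) hs
      (EV.of_subsingleton_left _) (hG 0 j)
  | succ n ih =>
    intro X _ _ G _ _ d ε hG hz hs h0 h1 j hj
    obtain ⟨j, rfl⟩ : ∃ k, j = k + 1 := ⟨j - 1, by omega⟩
    refine EV.left₃ (Submodule.subtype_injective _) (LinearMap.exact_subtype_ker_map ε) hs
      ?_ (hG 0 j)
    refine ih (LinearMap.ker ε) (fun i => G (i+1)) (fun i => d (i+1))
      ((d 0).codRestrict (LinearMap.ker ε) fun x => h0.apply_apply_eq_zero x)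
      (fun i j => hG (i+1) j) (fun i hi => hz (i+1) (by omega)) ?_ ?_ (fun i => h1 (i+1)) j (by omega)
    · intro x
      obtain ⟨y, hy⟩ := (h0 x).1 x.2
      exact ⟨y, Subtype.ext hy⟩
    · intro y
      rw [← h1 0 y]
      exact Subtype.ext_iff

lemma res_right {A : Type} [CommRing A] {X : Type} [AddCommGroup X] [Module A X] (n : ℕ) :
    ∀ (Y : Type) [AddCommGroup Y] [Module A Y] (G : ℕ → Type) [∀ i, AddCommGroup (G i)]
      [∀ i, Module A (G i)] (d : ∀ i, G i →ₗ[A] G (i+1)) (ε : Y →ₗ[A] G 0)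
      (_ : ∀ i j, EV A X (G i) (j+1)) (_ : ∀ i, n < i → Subsingleton (G i))
      (_ : Function.Injective ε) (_ : Function.Exact ε (d 0))
      (_ : ∀ i, Function.Exact (d i) (d (i+1))) (j : ℕ), n < j → EV A X Y j := by
  induction n with
  | zero =>
    intro Y _ _ G _ _ d ε hG hz hs h0 h1 j hj
    obtain ⟨j, rfl⟩ : ∃ k, j = k + 1 := ⟨j - 1, by omega⟩
    have hz1 := hz 1 (by omega)
    have hex : Function.Exact ε (d 0).rangeRestrict := by
      intro y; rw [← h0 y]; simp [Subtype.ext_iff]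
    exact EV.right₁ hs hex (d 0).surjective_rangeRestrict
      (EV.of_subsingleton_right _) (hG 0 j)
  | succ n ih =>
    intro Y _ _ G _ _ d ε hG hz hs h0 h1 j hj
    obtain ⟨j, rfl⟩ : ∃ k, j = k + 1 := ⟨j - 1, by omega⟩
    have hex : Function.Exact ε (d 0).rangeRestrict := by
      intro y; rw [← h0 y]; simp [Subtype.ext_iff]
    refine EV.right₁ hs hex (d 0).surjective_rangeRestrict ?_ (hG 0 j)
    refine ih (LinearMap.range (d 0)) (fun i => G (i+1)) (fun i => d (i+1))
      (LinearMap.range (d 0)).subtype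
      (fun i j => hG (i+1) j) (fun i hi => hz (i+1) (by omega)) (Submodule.subtype_injective _) ?_
      (fun i => h1 (i+1)) j (by omega)
    intro y
    rw [h1 0 y]
    simp

lemma chain_exact {A : Type} [CommRing A] (G : ChainComplex (ModuleCat.{0} A) ℕ) (i : ℕ)
    (h : G.ExactAt (i+1)) : Function.Exact (G.d (i+2) (i+1)).hom (G.d (i+1) i).hom := by
  rw [HomologicalComplex.exactAt_iff' _ (i+2) (i+1) i (by simp) (by simp)] at h
  exact (ShortComplex.ShortExact.moduleCat_exact_iff_function_exact _).1 h

lemma cochain_exact {A : Type} [CommRing A] (G : CochainComplex (ModuleCat.{0} A) ℕ) (i : ℕ)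
    (h : G.ExactAt (i+1)) : Function.Exact (G.d i (i+1)).hom (G.d (i+1) (i+2)).hom := by
  rw [HomologicalComplex.exactAt_iff' _ i (i+1) (i+2) (by simp) (by simp)] at h
  exact (ShortComplex.ShortExact.moduleCat_exact_iff_function_exact _).1 h

lemma PdLE.ev {A : Type} [CommRing A] {X Y : Type} [AddCommGroup X] [Module A X] [AddCommGroup Y]
    [Module A Y] {n : ℕ} (h : PdLE A (ModuleCat.of A X) n) (j : ℕ) (hj : n < j) : EV A X Y j := by
  obtain ⟨G, ε, hp, hz, he, ⟨w, h0⟩, h1⟩ := h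
  refine res_left n X (fun i => G.X i) (fun i => (G.d (i+1) i).hom) ε.hom ?_ ?_ ?_ ?_ ?_ j hj
  · intro i j
    have := (IsProjective.iff_projective (G.X i)).2 (hp i)
    exact EV.of_projective j
  · intro i hi
    exact ModuleCat.subsingleton_of_isZero (hz i hi)
  · exact (ModuleCat.epi_iff_surjective _).1 he
  · exact (ShortComplex.ShortExact.moduleCat_exact_iff_function_exact _).1 h0
  · intro i; exact chain_exact G i (h1 _ (by omega))

lemma GDimLE.ev {A : Type} [CommRing A] {X : Type} [AddCommGroup X] [Module A X] 
    {n : ℕ} (h : GDimLE A (ModuleCat.of A X) n) (j : ℕ) (hj : n < j) : EV A X A j := by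
  obtain ⟨G, ε, hp, hz, he, ⟨w, h0⟩, h1⟩ := h
  refine res_left n X (fun i => G.X i) (fun i => (G.d (i+1) i).hom) ε.hom ?_ ?_ ?_ ?_ ?_ j hj
  · intro i j
    by_cases hi : i ≤ n
    · exact (extMod_isZero_iff A (G.X i) A (j+1)).1 ((hp i hi).2.2.1 (j+1) (by omega))
    · have := ModuleCat.subsingleton_of_isZero (hz i (by omega))
      exact EV.of_subsingleton_left _
  · intro i hi
    exact ModuleCat.subsingleton_of_isZero (hz i hi)
  · exact (ModuleCat.epi_iff_surjective _).1 he
  · exact (ShortComplex.ShortExact.moduleCat_exact_iff_function_exact _).1 h0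
  · intro i; exact chain_exact G i (h1 _ (by omega))

lemma gorD_of {A : Type} [CommRing A] (h : HasFiniteInjDim A (ModuleCat.of A A)) :
    ∃ d, GorD A d := by
  obtain ⟨n, G, ε, hp, hz, he, ⟨w, h0⟩, h1⟩ := h
  refine ⟨n, fun X _ _ j hj => ?_⟩
  refine res_right n A (fun i => G.X i) (fun i => (G.d i (i+1)).hom) ε.hom ?_ ?_ ?_ ?_ ?_ j hj
  · intro i j
    exact EV.of_injective (hp i) j
  · intro i hi
    exact ModuleCat.subsingleton_of_isZero (hz i hi)
  · exact (ModuleCat.mono_iff_injective _).1 he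
  · exact (ShortComplex.ShortExact.moduleCat_exact_iff_function_exact _).1 h0
  · intro i; exact cochain_exact G i (h1 _ (by omega))

lemma grade_ev {A : Type} [CommRing A] {X : Type} [AddCommGroup X] [Module A X] (j : ℕ)
    (hj : (j : ℕ∞) < gradeM A (ModuleCat.of A X)) : EV A X A j := by
  rw [← extMod_isZero_iff]
  by_contra hc
  exact absurd hj (not_lt.2 (sInf_le ⟨j, rfl, hc⟩))

lemma sInf_attained (p : ℕ → Prop) {n : ℕ} (h : sInf {c : ℕ∞ | ∃ n : ℕ, c = n ∧ p n} = (n : ℕ∞)) :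
    p n := by
  have hne : {c : ℕ∞ | ∃ n : ℕ, c = n ∧ p n}.Nonempty := by
    by_contra hc
    rw [Set.not_nonempty_iff_eq_empty] at hc
    rw [hc, sInf_empty] at h
    exact ENat.natCast_ne_top n h.symm
  obtain ⟨m, hm, hp⟩ := csInf_mem hne
  rw [h] at hm
  rw [ENat.natCast_inj.1 hm]; exact hp

lemma perfect_M {A : Type} [CommRing A] {M : Type} [AddCommGroup M] [Module A M] {n : ℕ}
    (h1 : IsGPerfect A (ModuleCat.of A M)) (h2 : gdim A (ModuleCat.of A M) = (n : ℕ∞)) (i : ℕ)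
    (hi : i ≠ n) : EV A M A i := by
  rcases lt_or_gt_of_ne hi with h | h
  · exact grade_ev i (by rw [h1, h2]; exact_mod_cast h)
  · exact GDimLE.ev (sInf_attained _ h2) i h

lemma perfect_S {A : Type} [CommRing A] [IsNoetherianRing A] {d : ℕ} (hd : GorD A d) {c : Ideal A}
    (hne : Nontrivial (A ⧸ c)) (h : IsPerfectIdeal A c) :
    ∃ g, PdLE A (ModuleCat.of A (A ⧸ c)) g ∧ ∀ i, i ≠ g → EV A (A ⧸ c) A i := by
  have hfin : pdim A (ModuleCat.of A (A ⧸ c)) ≠ ⊤ := by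
    intro ht
    have hE : ∀ i, EV A (A ⧸ c) A i := fun i => grade_ev i (by rw [h, ht]; exact ENat.natCast_lt_top i)
    have h0 := EV.zero_iff.1 (hE 0)
    apply one_ne_zero (α := A ⧸ c)
    refine eval_inj hd (A ⧸ c) (fun j => hE (j+1)) _ fun φ => ?_
    rw [h0 φ]; rfl
  obtain ⟨g, hg⟩ := ENat.ne_top_iff_exists.1 hfin
  have hpd : PdLE A (ModuleCat.of A (A ⧸ c)) g := sInf_attained _ hg.symm
  refine ⟨g, hpd, fun i hi => ?_⟩
  rcases lt_or_gt_of_ne hi with hlt | hgt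
  · refine grade_ev i (lt_of_lt_of_eq ?_ (hg.trans h.symm))
    exact_mod_cast hlt
  · exact hpd.ev i hgt
end Bridge

/-- Exactness at spot `j` of a family of maps. -/
def ExAt (E : ℤ → Type) [∀ i, Zero (E i)] (d : ∀ i j, E i → E j) (j : ℤ) : Prop :=
  ∀ i k, i = j + 1 → j = k + 1 → Function.Exact (d i j) (d j k)

section Cplx
variable {S : Type} [CommRing S]

/-- Exactness at spot `j` of the dual family. -/
def DExAt (E : ℤ → Type) [∀ i, AddCommGroup (E i)] [∀ i, Module S (E i)]
    (d : ∀ i j, E i →ₗ[S] E j) (j : ℤ) : Prop :=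
  ∀ i k, i = j + 1 → j = k + 1 → ∀ h : E j →ₗ[S] S, h ∘ₗ d i j = 0 →
    ∃ l : E k →ₗ[S] S, l ∘ₗ d j k = h

variable {E : ℤ → Type} [∀ i, AddCommGroup (E i)] [∀ i, Module S (E i)]
    (d : ∀ i j, E i →ₗ[S] E j)

lemma coker_ses {j k l : ℤ} (hex : Function.Exact (d j k) (d k l)) :
    Function.Injective ((LinearMap.range (d j k)).liftQ (d k l)
      (LinearMap.exact_iff.1 hex).ge) ∧
    Function.Exact ((LinearMap.range (d j k)).liftQ (d k l) (LinearMap.exact_iff.1 hex).ge)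
      (LinearMap.range (d k l)).mkQ := by
  constructor
  · rw [← LinearMap.ker_eq_bot]
    exact Submodule.ker_liftQ_eq_bot _ _ _ (LinearMap.exact_iff.1 hex).le
  · rw [LinearMap.exact_iff, Submodule.ker_mkQ, Submodule.range_liftQ]

lemma coker_ev {e : ℕ} (he : GorD S e) (hE : ∀ i q, EV S (E i) S (q+1)) (m : ℕ) :
    ∀ (j k : ℤ) (_ : j = k + 1) (q : ℕ) (_ : e ≤ q + m)
      (_ : ∀ i, k - m < i → i ≤ k → ExAt E (fun i j => d i j) i),
      EV S (E k ⧸ LinearMap.range (d j k)) S (q+1) := by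
  induction m with
  | zero =>
    intro j k hjk q hq hex
    exact he _ _ (by omega)
  | succ m ih =>
    intro j k hjk q hq hex
    obtain ⟨l, hl⟩ : ∃ l, k = l + 1 := ⟨k - 1, by omega⟩
    have hx := hex k (by push_cast; omega) le_rfl j l hjk hl
    obtain ⟨h1, h2⟩ := coker_ses d hx
    refine EV.left₁ h1 h2 (Submodule.mkQ_surjective _) (hE l q) ?_
    refine ih k l hl (q+1) (by omega) fun i hi hi' => hex i (by push_cast; omega) (by omega)

lemma dex_of_ex {e : ℕ} (he : GorD S e) (hE : ∀ i q, EV S (E i) S (q+1)) (j : ℤ)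
    (hex : ∀ i, j - e ≤ i → i ≤ j → ExAt E (fun i j => d i j) i) : DExAt E d j := by
  intro i k hi hk h hh
  have hx := hex j (by omega) le_rfl i k hi hk
  obtain ⟨h1, h2⟩ := coker_ses d hx
  have hev := coker_ev d he hE e j k hk 0 (by omega) fun i hi hi' => hex i (by omega) (by omega)
  have hle : LinearMap.range (d i j) ≤ LinearMap.ker h := by
    rintro _ ⟨x, rfl⟩
    exact LinearMap.congr_fun hh x
  obtain ⟨ψ, hψ⟩ := EV.extend h1 h2 (Submodule.mkQ_surjective _) hev ((LinearMap.range (d i j)).liftQ h hle)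
  refine ⟨ψ, ?_⟩
  ext x
  exact LinearMap.congr_fun hψ (Submodule.Quotient.mk x)

lemma ex_of_dex [IsNoetherianRing S] {e : ℕ} (he : GorD S e) [∀ i, Module.Finite S (E i)]
    (hE : ∀ i q, EV S (E i) S (q+1))
    (hdd : ∀ i j k, i = j + 1 → j = k + 1 → d j k ∘ₗ d i j = 0) (j : ℤ)
    (hex : ∀ i, j ≤ i → i ≤ j + e → DExAt E d i) : ExAt E (fun i j => d i j) j := by
  intro i k hi hk
  have key := dex_of_ex (S := S) (E := fun i => (E (-i) →ₗ[S] S))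
    (fun i j => LinearMap.lcomp S S (d (-j) (-i))) he (fun i q => EV.dual' he _ (hE (-i)) q) (-j) (by
      intro a ha ha' b c hb hc
      have h1 := hex (-a) (by omega) (by omega) (-c) (-b) (by omega) (by omega)
      intro h
      constructor
      · intro hh
        obtain ⟨l, hl⟩ := h1 h hh
        exact ⟨l, hl⟩
      · rintro ⟨l, rfl⟩
        change (l ∘ₗ d (-a) (-b)) ∘ₗ d (-c) (-a) = 0
        rw [LinearMap.comp_assoc, hdd _ _ _ (by omega) (by omega), LinearMap.comp_zero])
  intro x
  constructor
  · intro hx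
    obtain ⟨j, rfl⟩ : ∃ j', j = -j' := ⟨-j, by omega⟩
    obtain ⟨i, rfl⟩ : ∃ j', i = -j' := ⟨-i, by omega⟩
    obtain ⟨k, rfl⟩ : ∃ j', k = -j' := ⟨-k, by omega⟩
    rw [neg_neg] at key
    obtain ⟨l, hl⟩ := key k i (by omega) (by omega) (LinearMap.applyₗ x) (by
      refine LinearMap.ext fun φ => ?_
      change φ (d (-j) (-k) x) = 0
      rw [show d (-j) (-k) x = 0 from hx, map_zero])
    obtain ⟨y, hy⟩ := eval_surj he (E (-i)) (hE (-i)) l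
    refine ⟨y, ?_⟩
    rw [← sub_eq_zero]
    refine eval_inj he (E (-j)) (hE (-j)) _ fun φ => ?_
    have h2 := LinearMap.congr_fun hl φ
    change l (φ ∘ₗ d (-i) (-j)) = φ x at h2
    rw [hy] at h2
    rw [map_sub, sub_eq_zero]
    exact h2
  · rintro ⟨y, rfl⟩
    exact LinearMap.congr_fun (hdd i j k hi hk) y
end Cplx

section Chase
variable {A : Type} [CommRing A]
variable {E F G : ℤ → Type} [∀ i, AddCommGroup (E i)] [∀ i, Module A (E i)]
  [∀ i, AddCommGroup (F i)] [∀ i, Module A (F i)] [∀ i, AddCommGroup (G i)] [∀ i, Module A (G i)]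
  {dE : ∀ i j, E i →ₗ[A] E j} {dF : ∀ i j, F i →ₗ[A] F j} {dG : ∀ i j, G i →ₗ[A] G j}
  (f : ∀ i, E i →ₗ[A] F i) (g : ∀ i, F i →ₗ[A] G i)
  (hf : ∀ i, Function.Injective (f i)) (hfg : ∀ i, Function.Exact (f i) (g i))
  (hg : ∀ i, Function.Surjective (g i))
  (cf : ∀ i j x, f j (dE i j x) = dF i j (f i x)) (cg : ∀ i j x, g j (dF i j x) = dG i j (g i x))
  (hF : ∀ j, ExAt F (fun i j => dF i j) j)

include hf hfg hg cf cg hF in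
lemma chase (j k : ℤ) (hjk : j = k + 1) :
    ExAt G (fun i j => dG i j) j ↔ ExAt E (fun i j => dE i j) k := by
  have ddF : ∀ i j k, i = j + 1 → j = k + 1 → ∀ x, dF j k (dF i j x) = 0 :=
    fun i j k h h' x => (hF j i k h h').apply_apply_eq_zero x
  have ddE : ∀ i j k, i = j + 1 → j = k + 1 → ∀ x, dE j k (dE i j x) = 0 := by
    intro i j k h h' x
    apply hf
    rw [cf, cf, ddF i j k h h', map_zero]
  have ddG : ∀ i j k, i = j + 1 → j = k + 1 → ∀ x, dG j k (dG i j x) = 0 := by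
    intro i j k h h' x
    obtain ⟨x, rfl⟩ := hg _ x
    rw [← cg, ← cg, ddF i j k h h', map_zero]
  constructor
  · intro hG j' l hj' hl
    obtain rfl : j' = j := by omega
    intro a
    constructor
    · intro ha
      dsimp only at ha
      obtain ⟨b, hb⟩ := (hF k j' l hj' hl (f k a)).1 (by dsimp only; rw [← cf, ha, map_zero])
      dsimp only at hb
      obtain ⟨c, hc⟩ := (hG (j'+1) k rfl hjk (g j' b)).1 (by
        dsimp only
        rw [← cg, hb]; exact (hfg k).apply_apply_eq_zero a)
      dsimp only at hc
      obtain ⟨b', rfl⟩ := hg _ c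
      obtain ⟨a', ha'⟩ := (hfg j' (b - dF (j'+1) j' b')).1 (by
        rw [map_sub, cg, hc, sub_self])
      refine ⟨a', hf _ ?_⟩
      dsimp only
      rw [cf, ha', map_sub, hb, ddF _ _ _ rfl hjk, sub_zero]
    · rintro ⟨a', rfl⟩
      exact ddE _ _ _ hj' hl a'
  · intro hE i k' hi hk'
    obtain rfl : k' = k := by omega
    intro c
    constructor
    · intro hc
      dsimp only at hc
      obtain ⟨b, rfl⟩ := hg _ c
      obtain ⟨a, ha⟩ := (hfg k' (dF j k' b)).1 (by rw [cg, hc])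
      obtain ⟨l, hl⟩ : ∃ l, k' = l + 1 := ⟨k' - 1, by omega⟩
      obtain ⟨a', ha'⟩ := (hE j l hjk hl a).1 (by
        apply hf
        dsimp only
        rw [cf, ha, ddF _ _ _ hjk hl, map_zero])
      dsimp only at ha'
      obtain ⟨b', hb'⟩ := (hF j i k' hi hjk (b - f j a')).1 (by
        dsimp only
        rw [map_sub, ← cf, ha', ha, sub_self])
      dsimp only at hb'
      refine ⟨g i b', ?_⟩
      dsimp only
      rw [← cg, hb', map_sub, (hfg j).apply_apply_eq_zero, sub_zero]
    · rintro ⟨a', rfl⟩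
      exact ddG _ _ _ hi hjk a'
end Chase

section Tens
open TensorProduct
variable {A : Type} [CommRing A]
variable (T : ℤ → Type) [∀ i, AddCommGroup (T i)] [∀ i, Module A (T i)] [∀ i, Module.Flat A (T i)]
  (dT : ∀ i j, T i →ₗ[A] T j) (hT : ∀ j, ExAt T (fun i j => dT i j) j)

/-- The complex `X ⊗ T` is exact at `j`. -/
def TEx (X : Type) [AddCommGroup X] [Module A X] (j : ℤ) : Prop :=
  ExAt (fun i => X ⊗[A] T i) (fun i j => (dT i j).lTensor X) j

lemma tens_chase {X Y Z : Type} [AddCommGroup X] [Module A X] [AddCommGroup Y] [Module A Y]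
    [AddCommGroup Z] [Module A Z] (f : X →ₗ[A] Y) (g : Y →ₗ[A] Z) (hf : Function.Injective f)
    (hfg : Function.Exact f g) (hg : Function.Surjective g) (hY : ∀ j, TEx T dT Y j) (j k : ℤ)
    (hjk : j = k + 1) : TEx T dT Z j ↔ TEx T dT X k := by
  refine chase (E := fun i => X ⊗[A] T i) (F := fun i => Y ⊗[A] T i) (G := fun i => Z ⊗[A] T i)
    (fun i => f.rTensor (T i)) (fun i => g.rTensor (T i))
    (fun i => Module.Flat.rTensor_preserves_injective_linearMap f hf)
    (fun i => rTensor_exact (T i) hfg hg) (fun i => LinearMap.rTensor_surjective _ hg) ?_ ?_ hY j k hjk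
  · intro i j x
    change (f.rTensor (T j) ∘ₗ (dT i j).lTensor X) x = ((dT i j).lTensor Y ∘ₗ f.rTensor (T i)) x
    rw [LinearMap.rTensor_comp_lTensor, LinearMap.lTensor_comp_rTensor]
  · intro i j x
    change (g.rTensor (T j) ∘ₗ (dT i j).lTensor Y) x = ((dT i j).lTensor Z ∘ₗ g.rTensor (T i)) x
    rw [LinearMap.rTensor_comp_lTensor, LinearMap.lTensor_comp_rTensor]

include hT in
lemma tens_flat (X : Type) [AddCommGroup X] [Module A X] [Module.Flat A X] (j : ℤ) :
    TEx T dT X j := by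
  intro i k hi hk
  exact Module.Flat.lTensor_exact X (hT j i k hi hk)

include hT in
lemma res_tens (n : ℕ) :
    ∀ (X : Type) [AddCommGroup X] [Module A X] (G : ℕ → Type) [∀ i, AddCommGroup (G i)]
      [∀ i, Module A (G i)] (d : ∀ i, G (i+1) →ₗ[A] G i) (ε : G 0 →ₗ[A] X)
      (_ : ∀ i, Module.Flat A (G i)) (_ : ∀ i, n < i → Subsingleton (G i))
      (_ : Function.Surjective ε) (_ : Function.Exact (d 0) ε)
      (_ : ∀ i, Function.Exact (d (i+1)) (d i)) (j : ℤ), TEx T dT X j := by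
  induction n with
  | zero =>
    intro X _ _ G _ _ d ε hG hz hs h0 h1 j
    have hz1 := hz 1 (by omega)
    have : Subsingleton (LinearMap.ker ε) := by
      refine ⟨fun a b => ?_⟩
      obtain ⟨a', ha⟩ := (h0 a).1 a.2
      obtain ⟨b', hb⟩ := (h0 b).1 b.2
      ext1
      rw [← ha, ← hb, Subsingleton.elim a' b']
    rw [tens_chase T dT (LinearMap.ker ε).subtype ε (Submodule.subtype_injective _)
      (LinearMap.exact_subtype_ker_map ε) hs (tens_flat T dT hT _) j (j-1) (by omega)]
    exact tens_flat T dT hT _ _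
  | succ n ih =>
    intro X _ _ G _ _ d ε hG hz hs h0 h1 j
    rw [tens_chase T dT (LinearMap.ker ε).subtype ε (Submodule.subtype_injective _)
      (LinearMap.exact_subtype_ker_map ε) hs (tens_flat T dT hT _) j (j-1) (by omega)]
    refine ih (LinearMap.ker ε) (fun i => G (i+1)) (fun i => d (i+1))
      ((d 0).codRestrict (LinearMap.ker ε) fun x => h0.apply_apply_eq_zero x)
      (fun i => hG (i+1)) (fun i hi => hz (i+1) (by omega)) ?_ ?_ (fun i => h1 (i+1)) (j-1)
    · intro x
      obtain ⟨y, hy⟩ := (h0 x).1 x.2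
      exact ⟨y, Subtype.ext hy⟩
    · intro y
      rw [← h1 0 y]
      exact Subtype.ext_iff

lemma exact_compLeft {X Y Z : Type} [AddCommGroup X] [Module A X] [AddCommGroup Y] [Module A Y]
    [AddCommGroup Z] [Module A Z] (f : X →ₗ[A] Y) (g : Y →ₗ[A] Z) (h : Function.Exact f g) (k : ℕ) :
    Function.Exact (f.compLeft (Fin k)) (g.compLeft (Fin k)) := by
  intro y
  constructor
  · intro hy
    have : ∀ i, ∃ x, f x = y i := fun i => (h (y i)).1 (congrFun hy i)
    choose x hx using this
    exact ⟨x, funext hx⟩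
  · rintro ⟨x, rfl⟩
    funext i
    exact h.apply_apply_eq_zero (x i)

lemma pi_flat_of_proj (Y : Type) [AddCommGroup Y] [Module A Y] [Module.Projective A Y] (k : ℕ) :
    Module.Flat A (Fin k → Y) := by
  have h1 : Module.Flat A Y := Module.Flat.of_projective
  exact Module.Flat.of_linearEquiv
    ((Finsupp.linearEquivFunOnFinite A Y (Fin k)).symm.trans (finsuppLEquivDirectSum A Y (Fin k)))

include hT in
lemma PdLE.tens {X : Type} [AddCommGroup X] [Module A X] {n : ℕ} (h : PdLE A (ModuleCat.of A X) n)
    (k : ℕ) (j : ℤ) : TEx T dT (Fin k → X) j := by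
  obtain ⟨G, ε, hp, hz, he, ⟨w, h0⟩, h1⟩ := h
  refine res_tens T dT hT n (Fin k → X) (fun i => (Fin k → G.X i))
    (fun i => (G.d (i+1) i).hom.compLeft (Fin k)) (ε.hom.compLeft (Fin k)) ?_ ?_ ?_ ?_ ?_ j
  · intro i
    have := (IsProjective.iff_projective (G.X i)).2 (hp i)
    exact pi_flat_of_proj _ k
  · intro i hi
    have := ModuleCat.subsingleton_of_isZero (hz i hi)
    infer_instance
  · intro y
    have hs := (ModuleCat.epi_iff_surjective _).1 he
    choose x hx using fun i => hs (y i)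
    exact ⟨x, funext hx⟩
  · exact exact_compLeft _ _ ((ShortComplex.ShortExact.moduleCat_exact_iff_function_exact _).1 h0) k
  · intro i; exact exact_compLeft _ _ (chain_exact G i (h1 _ (by omega))) k
end Tens

section Lam
variable {S : Type} [CommRing S] [IsLocalRing S]

lemma emb_of_lambda {X Y : Type} [AddCommGroup X] [Module S X] [AddCommGroup Y] [Module S Y]
    (h : IsLambdaOf S X Y) : ∃ (k : ℕ) (ι : Y →ₗ[S] (Fin k → S)), Function.Injective ι := by
  obtain ⟨n₀, n₁, g, f, -, -, -, -, ⟨e⟩⟩ := h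
  refine ⟨n₁, ((Pi.basisFun S (Fin n₁)).constr S).symm.toLinearMap ∘ₗ
    (LinearMap.range f.dualMap).subtype ∘ₗ e.toLinearMap, ?_⟩
  exact ((Pi.basisFun S (Fin n₁)).constr S).symm.injective.comp
    ((Submodule.subtype_injective _).comp e.injective)

lemma ses_of_lambda {X Y : Type} [AddCommGroup X] [Module S X] [AddCommGroup Y] [Module S Y]
    (h : IsLambdaOf S X Y) : ∃ (k : ℕ) (a : (X →ₗ[S] S) →ₗ[S] (Fin k → S))
      (b : (Fin k → S) →ₗ[S] Y), Function.Injective a ∧ Function.Exact a b ∧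
      Function.Surjective b := by
  obtain ⟨n₀, n₁, g, f, hg, hfg, -, -, ⟨e⟩⟩ := h
  let c := ((Pi.basisFun S (Fin n₀)).constr S : (Fin n₀ → S) ≃ₗ[S] ((Fin n₀ → S) →ₗ[S] S))
  refine ⟨n₀, c.symm.toLinearMap ∘ₗ LinearMap.lcomp S S g,
    e.symm.toLinearMap ∘ₗ f.dualMap.rangeRestrict ∘ₗ c.toLinearMap, ?_, ?_, ?_⟩
  · refine c.symm.injective.comp fun φ ψ h => ?_
    ext x
    obtain ⟨y, rfl⟩ := hg x
    exact LinearMap.congr_fun h y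
  · intro y
    obtain ⟨φ, rfl⟩ := c.symm.surjective y
    constructor
    · intro h
      have h1 : f.dualMap φ = 0 := by
        have h2 : e.symm (f.dualMap.rangeRestrict (c (c.symm φ))) = 0 := h
        rw [LinearEquiv.map_eq_zero_iff, LinearEquiv.apply_symm_apply] at h2
        exact congrArg Subtype.val h2
      have hle : LinearMap.ker g ≤ LinearMap.ker φ := by
        rw [← hfg]
        rintro _ ⟨x, rfl⟩
        exact LinearMap.congr_fun h1 x
      refine ⟨(LinearMap.ker g).liftQ φ hle ∘ₗ (g.quotKerEquivOfSurjective hg).symm.toLinearMap, ?_⟩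
      change c.symm _ = c.symm _
      congr 1
      refine LinearMap.ext fun x => ?_
      change (LinearMap.ker g).liftQ φ hle ((g.quotKerEquivOfSurjective hg).symm (g x)) = φ x
      have : (g.quotKerEquivOfSurjective hg).symm (g x) = Submodule.Quotient.mk x := by
        rw [LinearEquiv.symm_apply_eq]
        rfl
      rw [this]
      rfl
    · rintro ⟨ψ, hψ⟩
      rw [← hψ]
      change e.symm (f.dualMap.rangeRestrict (c (c.symm (ψ ∘ₗ g)))) = 0
      rw [LinearEquiv.map_eq_zero_iff, LinearEquiv.apply_symm_apply]
      refine Subtype.ext (LinearMap.ext fun x => ?_)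
      change ψ (g (f x)) = 0
      have : f x ∈ LinearMap.ker g := hfg ▸ LinearMap.mem_range_self f x
      rw [LinearMap.mem_ker.1 this, map_zero]
  · exact e.symm.surjective.comp (LinearMap.surjective_rangeRestrict _ |>.comp c.surjective)
end Lam

section Fin
open TensorProduct
variable {A : Type} [CommRing A] {S : Type} [CommRing S] [Algebra A S]
  (D : Type) [AddCommGroup D] [Module A D] [Module S D] [IsScalarTower A S D]
  (T : Type) [AddCommGroup T] [Module A T] [Module.Projective A T] [Module.Finite A T]

lemma tens_retract : ∃ (k : ℕ) (i : D ⊗[A] T →ₗ[S] (Fin k → D)) (p : (Fin k → D) →ₗ[S] D ⊗[A] T),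
    p ∘ₗ i = LinearMap.id := by
  obtain ⟨k, f, hf⟩ := Module.Finite.exists_fin' A T
  obtain ⟨s, hs⟩ := Module.projective_lifting_property f LinearMap.id hf
  let e := TensorProduct.piScalarRight A S D (Fin k)
  refine ⟨k, e.toLinearMap ∘ₗ AlgebraTensorModule.lTensor S D s,
    AlgebraTensorModule.lTensor S D f ∘ₗ e.symm.toLinearMap, ?_⟩
  ext x t
  have := LinearMap.congr_fun hs t
  simp only [LinearMap.comp_apply, LinearMap.id_apply] at this
  simp [this]

lemma tens_finite [Module.Finite S D] : Module.Finite S (D ⊗[A] T) := by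
  obtain ⟨k, i, p, h⟩ := tens_retract (A := A) (S := S) D T
  exact Module.Finite.of_surjective p fun x => ⟨i x, LinearMap.congr_fun h x⟩

lemma tens_ev {q : ℕ} (h : EV S D S q) : EV S (D ⊗[A] T) S q := by
  obtain ⟨k, i, p, hip⟩ := tens_retract (A := A) (S := S) D T
  exact EV.of_retract_left i p hip (h.pi_left k)
end Fin

section Adj
open TensorProduct
variable {A : Type} [CommRing A] {S : Type} [CommRing S] [Algebra A S]
  {M : Type} [AddCommGroup M] [Module A M] [Module S M] [IsScalarTower A S M]
  (hs : ∀ Φ : (M →ₗ[S] S) →ₗ[S] S, ∃ x, ∀ φ, Φ φ = φ x)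
  (hi : ∀ x : M, (∀ φ : M →ₗ[S] S, φ x = 0) → x = 0)
  (T : Type) [AddCommGroup T] [Module A T]

/-- The functional on `M^* ⊗ T` defined by a map `T → M`. -/
def toFun (k : T →ₗ[A] M) : (M →ₗ[S] S) ⊗[A] T →ₗ[S] S :=
  AlgebraTensorModule.lift
    { toFun := fun φ => (φ.restrictScalars A) ∘ₗ k
      map_add' := fun _ _ => rfl
      map_smul' := fun _ _ => rfl }

@[simp] lemma toFun_tmul (k : T →ₗ[A] M) (φ : M →ₗ[S] S) (t : T) : toFun T k (φ ⊗ₜ t) = φ (k t) := rfl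

include hs hi in
lemma exists_toFun (h : (M →ₗ[S] S) ⊗[A] T →ₗ[S] S) : ∃ k : T →ₗ[A] M, toFun T k = h := by
  have key : ∀ t : T, ∃ x : M, ∀ φ : M →ₗ[S] S, h (φ ⊗ₜ t) = φ x := fun t =>
    hs (h ∘ₗ (AlgebraTensorModule.mk A S (M →ₗ[S] S) T).flip t)
  choose k hk using key
  have inj : ∀ x y : M, (∀ φ : M →ₗ[S] S, φ x = φ y) → x = y := fun x y hxy => by
    rw [← sub_eq_zero]
    exact hi _ fun φ => by rw [map_sub, hxy, sub_self]
  refine ⟨{ toFun := k, map_add' := fun a b => inj _ _ fun φ => ?_,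
            map_smul' := fun r a => inj _ _ fun φ => ?_ }, ?_⟩
  · rw [← hk, tmul_add, map_add, hk, hk, map_add]
  · rw [← hk, tmul_smul, RingHom.id_apply, ← algebraMap_smul S r (k a), ← algebraMap_smul S r (φ ⊗ₜ[A] a),
      LinearMap.map_smul h, LinearMap.map_smul φ, ← hk]
  · ext φ t
    exact (hk t φ).symm

include hi in
lemma toFun_inj (k k' : T →ₗ[A] M) (h : toFun (S := S) T k = toFun T k') : k = k' := by
  ext t
  rw [← sub_eq_zero]
  refine hi _ fun φ => ?_
  rw [map_sub, sub_eq_zero]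
  exact LinearMap.congr_fun h (φ ⊗ₜ t)

lemma toFun_comp {T' : Type} [AddCommGroup T'] [Module A T'] (k : T →ₗ[A] M) (f : T' →ₗ[A] T) :
    toFun (S := S) T' (k ∘ₗ f) = toFun T k ∘ₗ AlgebraTensorModule.lTensor S (M →ₗ[S] S) f := by
  ext φ t
  rfl

include hs hi in
lemma dex_iff (C : ChainComplex (ModuleCat.{0} A) ℤ) (j : ℤ) :
    (C.linearYonedaObj A (ModuleCat.of A M)).ExactAt j ↔
    DExAt (S := S) (fun i => (M →ₗ[S] S) ⊗[A] C.X i)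
      (fun i j => AlgebraTensorModule.lTensor S (M →ₗ[S] S) (C.d i j).hom) j := by
  constructor
  · intro h i k hi' hk' f hf
    rw [exactAt_yoneda_iff C _ k j i (by omega) (by omega)] at h
    obtain ⟨u, rfl⟩ := exists_toFun hs hi _ f
    obtain ⟨l, hl⟩ := h (ModuleCat.ofHom u) (by
      ext1
      refine toFun_inj (S := S) hi _ _ _ ?_
      refine (toFun_comp _ u _).trans ?_
      refine hf.trans ?_
      ext φ t
      exact (map_zero φ).symm)
    refine ⟨toFun _ l.hom, ?_⟩
    rw [← toFun_comp]
    exact congrArg (toFun _) (congrArg ModuleCat.Hom.hom hl)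
  · intro h
    rw [exactAt_yoneda_iff C _ (j-1) j (j+1) (by omega) (by omega)]
    intro f hf
    obtain ⟨l, hl⟩ := h (j+1) (j-1) (by omega) (by omega) (toFun _ f.hom) (by
      rw [← toFun_comp]
      have h1 : f.hom ∘ₗ (C.d (j+1) j).hom = 0 := congrArg ModuleCat.Hom.hom hf
      rw [h1]
      ext φ t
      exact map_zero φ)
    obtain ⟨u, rfl⟩ := exists_toFun hs hi _ l
    refine ⟨ModuleCat.ofHom u, ?_⟩
    ext1
    refine toFun_inj (S := S) hi _ _ _ ?_
    exact (toFun_comp _ u _).trans hl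
end Adj

section Tor
open TensorProduct
variable {A : Type} [CommRing A]

lemma exactT_iff (C : ChainComplex (ModuleCat.{0} A) ℤ) (j : ℤ) :
    C.ExactAt j ↔ ExAt (fun i => C.X i) (fun i j => (C.d i j).hom) j := by
  constructor
  · intro h i k hi hk
    rw [HomologicalComplex.exactAt_iff' C i j k (by simp; omega) (by simp; omega)] at h
    exact (ShortComplex.ShortExact.moduleCat_exact_iff_function_exact _).1 h
  · intro h
    rw [HomologicalComplex.exactAt_iff' C (j+1) j (j-1) (by simp) (by simp)]
    exact (ShortComplex.ShortExact.moduleCat_exact_iff_function_exact _).2 (h _ _ rfl (by omega))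

lemma tor_iff {L : ModuleCat.{0} A} (CL : CompleteResolution A L) (N : Type) [AddCommGroup N]
    [Module A N] (j : ℤ) : IsZero (TateTor A CL (ModuleCat.of A N) j) ↔
      TEx (fun i => CL.T.X i) (fun i j => (CL.T.d i j).hom) N j := by
  unfold TateTor
  rw [← HomologicalComplex.exactAt_iff_isZero_homology, exactT_iff]
  unfold TEx ExAt
  refine forall_congr' fun i => forall_congr' fun k => forall_congr' fun _ => forall_congr' fun _ => ?_
  change Function.Exact ((CL.T.d i j).hom.rTensor N) ((CL.T.d j k).hom.rTensor N) ↔ _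
  refine Function.Exact.iff_of_ladder_linearEquiv (e₁ := TensorProduct.comm _ _ _)
    (e₂ := TensorProduct.comm _ _ _) (e₃ := TensorProduct.comm _ _ _) ?_ ?_ |>.symm
  · ext; rfl
  · ext; rfl
end Tor

/-- Let `R` be a Gorenstein local ring, `c` a perfect Gorenstein ideal, and `L` a finitely
generated `R`-module. Assume `M ∈ CM^n(R)` (i.e. `M` is G-perfect of G-dimension `n`) and
`M ∼_c N`. Then: (i) `Êxt^i_R(L,M) = 0` for `i ≫ 0` iff `T̂or_i^R(L,N) = 0` for `i ≫ 0`;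
(ii) the same for `i ≪ 0`; (iii) the same for all `i ∈ ℤ`. -/
theorem stmt_16 (R : Type) [CommRing R] [IsLocalRing R] (hR : IsGorensteinLocalRing R)
    (c : Ideal R) [IsLocalRing (R ⧸ c)]
    (hc₁ : IsGorensteinLocalRing (R ⧸ c)) (hc₂ : IsPerfectIdeal R c)
    (L : Type) [AddCommGroup L] [Module R L] [Module.Finite R L]
    (M N : Type) [AddCommGroup M] [Module R M] [Module.Finite R M]
    [Module (R ⧸ c) M] [IsScalarTower R (R ⧸ c) M]
    [AddCommGroup N] [Module R N] [Module.Finite R N]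
    [Module (R ⧸ c) N] [IsScalarTower R (R ⧸ c) N]
    (n : ℕ) (hMperf : IsGPerfect R (ModuleCat.of R M))
    (hMdim : gdim R (ModuleCat.of R M) = (n : ℕ∞))
    (hlink : LinkedBy R c M N)
    (CL : CompleteResolution R (ModuleCat.of R L)) :
    ((∃ n₀ : ℤ, ∀ i : ℤ, n₀ ≤ i → IsZero (TateExt R CL (ModuleCat.of R M) i)) ↔
      (∃ n₀ : ℤ, ∀ i : ℤ, n₀ ≤ i → IsZero (TateTor R CL (ModuleCat.of R N) i))) ∧
    ((∃ n₀ : ℤ, ∀ i : ℤ, i ≤ n₀ → IsZero (TateExt R CL (ModuleCat.of R M) i)) ↔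
      (∃ n₀ : ℤ, ∀ i : ℤ, i ≤ n₀ → IsZero (TateTor R CL (ModuleCat.of R N) i))) ∧
    ((∀ i : ℤ, IsZero (TateExt R CL (ModuleCat.of R M) i)) ↔
      (∀ i : ℤ, IsZero (TateTor R CL (ModuleCat.of R N) i))) := by
  classical
  have hN0 : IsNoetherianRing R := hR.2.1
  have hNS : IsNoetherianRing (R ⧸ c) := hc₁.2.1
  obtain ⟨d, hd⟩ := gorD_of hR.2.2
  obtain ⟨e, he⟩ := gorD_of hc₁.2.2
  have hfM : Module.Finite (R ⧸ c) M := Module.Finite.of_restrictScalars_finite R (R ⧸ c) M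
  obtain ⟨g, hpd, hE⟩ := perfect_S hd inferInstance hc₂
  have hMev : ∀ j, EV (R ⧸ c) M (R ⧸ c) (j+1) := by
    obtain ⟨k, ι, hι⟩ := emb_of_lambda hlink.1
    intro j
    exact main_vanish R hd (R ⧸ c) Ideal.Quotient.mk_surjective he hE M ι hι
      (fun i hi => perfect_M hMperf hMdim i hi) j
  have hs := eval_surj he M hMev
  have hi := eval_inj he M hMev
  have hDev := EV.dual' he M hMev
  have hfD : Module.Finite (R ⧸ c) (M →ₗ[R ⧸ c] (R ⧸ c)) := inferInstance
  have hpT : ∀ i, Module.Projective R (CL.T.X i) := fun i =>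
    (IsProjective.iff_projective (CL.T.X i)).2 (CL.projT i)
  have hfT : ∀ i, Module.Finite R (CL.T.X i) := CL.fgT
  have hflT : ∀ i, Module.Flat R (CL.T.X i) := fun i => Module.Flat.of_projective
  have hT := fun j => (exactT_iff CL.T j).1 (CL.exactT j)
  have tor : ∀ j, IsZero (TateTor R CL (ModuleCat.of R N) j) ↔
      TEx (fun i => CL.T.X i) (fun i j => (CL.T.d i j).hom) (M →ₗ[R ⧸ c] (R ⧸ c)) (j-1) := by
    intro j
    rw [tor_iff]
    obtain ⟨k, a, b, ha, hab, hb⟩ := ses_of_lambda hlink.2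
    exact tens_chase (fun i => CL.T.X i) (fun i j => (CL.T.d i j).hom) (a.restrictScalars R)
      (b.restrictScalars R) ha hab hb (fun j => PdLE.tens _ _ hT hpd k j) j (j-1) (by omega)
  have ext : ∀ j, IsZero (TateExt R CL (ModuleCat.of R M) j) ↔ _ := fun j =>
    (HomologicalComplex.exactAt_iff_isZero_homology _ _).symm.trans (dex_iff hs hi CL.T j)
  have hEfin : ∀ i, Module.Finite (R ⧸ c) (TensorProduct R (M →ₗ[R ⧸ c] (R ⧸ c)) (CL.T.X i)) :=
    fun i => tens_finite _ _
  have hEev : ∀ i q, EV (R ⧸ c) (TensorProduct R (M →ₗ[R ⧸ c] (R ⧸ c)) (CL.T.X i)) (R ⧸ c) (q+1) :=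
    fun i q => tens_ev _ _ (hDev q)
  have hdd : ∀ i j k : ℤ, i = j + 1 → j = k + 1 →
      TensorProduct.AlgebraTensorModule.lTensor (R ⧸ c) (M →ₗ[R ⧸ c] (R ⧸ c)) (CL.T.d j k).hom ∘ₗ
      TensorProduct.AlgebraTensorModule.lTensor (R ⧸ c) (M →ₗ[R ⧸ c] (R ⧸ c)) (CL.T.d i j).hom
        = 0 := by
    intro i j k _ _
    rw [← TensorProduct.AlgebraTensorModule.lTensor_comp, ← ModuleCat.hom_comp,
      HomologicalComplex.d_comp_d]
    ext x t
    simp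
  have F1 : ∀ j : ℤ, (∀ i, j - e ≤ i → i ≤ j → IsZero (TateTor R CL (ModuleCat.of R N) (i+1))) →
      IsZero (TateExt R CL (ModuleCat.of R M) j) := by
    intro j h
    refine (ext j).2 (dex_of_ex _ he hEev j fun i h1 h2 => ?_)
    have := (tor _).1 (h i h1 h2)
    rw [add_sub_cancel_right] at this
    exact this
  have F2 : ∀ j : ℤ, (∀ i, j ≤ i → i ≤ j + e → IsZero (TateExt R CL (ModuleCat.of R M) i)) →
      IsZero (TateTor R CL (ModuleCat.of R N) (j+1)) := by
    intro j h
    rw [tor, add_sub_cancel_right]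
    exact ex_of_dex _ he hEev hdd j fun i h1 h2 => (ext i).1 (h i h1 h2)
  refine ⟨⟨?_, ?_⟩, ⟨?_, ?_⟩, ⟨?_, ?_⟩⟩
  · rintro ⟨m, hm⟩
    refine ⟨m + 1, fun i h => ?_⟩
    have := F2 (i-1) fun q h1 h2 => hm q (by omega)
    rwa [sub_add_cancel] at this
  · rintro ⟨m, hm⟩
    exact ⟨m + e, fun i h => F1 i fun q h1 h2 => hm _ (by omega)⟩
  · rintro ⟨m, hm⟩
    refine ⟨m - e, fun i h => ?_⟩
    have := F2 (i-1) fun q h1 h2 => hm q (by omega)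
    rwa [sub_add_cancel] at this
  · rintro ⟨m, hm⟩
    exact ⟨m - 1, fun i h => F1 i fun q h1 h2 => hm _ (by omega)⟩
  · intro hm i
    have := F2 (i-1) fun q h1 h2 => hm q
    rwa [sub_add_cancel] at this
  · intro hm i
    exact F1 i fun q h1 h2 => hm _

end
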